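/- arXiv:2108.13271 — 6 statements merged into one kernel-verified Lean document; each statement's English description precedes it below -/
import Mathlib

section
/- Suppose (x̄, ū) is an optimal solution of the relaxed EDP (5). Then the relaxed inequality constraint is active at the optimum: Σ_{i∈V} ū_i² + Σ_{i∈V} d_i − Σ_{i∈V} x̄_i = 0. Consequently (x̄, ū) is also an optimal solution of the equality-constrained EDP obtained from (5) by replacing the inequality constraint with the equality Σ_{i∈V} u_i² + Σ_{i∈V} d_i − Σ_{i∈V} x_i = 0. -/
open Matrix Finset

/-- The quadratic form of a Gram matrix `RᵀR` is the squared Euclidean norm of `R x`. -/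
theorem dotProduct_transpose_mul_self_mulVec {n : ℕ} (R : Matrix (Fin n) (Fin n) ℝ)
    (x : Fin n → ℝ) : x ⬝ᵥ (Rᵀ * R).mulVec x = ∑ i, (R.mulVec x i) ^ 2 := by
  rw [← Matrix.mulVec_mulVec, Matrix.dotProduct_mulVec, Matrix.vecMul_transpose]
  simp [dotProduct, sq]

/-- A point other than the lower corner of a box can be moved slightly towards that corner, staying
in the box and in a given open sublevel set, and every separable strictly increasing cost drops. -/
theorem exists_mem_box_sum_lt {n : ℕ} {a b x : Fin n → ℝ} {C : Fin n → ℝ → ℝ}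
    (hC : ∀ i, StrictMonoOn (C i) (Set.Icc (a i) (b i)))
    (hx : ∀ i, x i ∈ Set.Icc (a i) (b i)) (hne : x ≠ a)
    {g : (Fin n → ℝ) → ℝ} (hg : Continuous g) (hgx : g x < 0) :
    ∃ y, (∀ i, y i ∈ Set.Icc (a i) (b i)) ∧ g y < 0 ∧ ∑ i, C i (y i) < ∑ i, C i (x i) := by
  have hcont : Continuous fun t : ℝ => g (x + t • (a - x)) := by fun_prop
  have hev : ∀ᶠ t in nhds (0 : ℝ), g (x + t • (a - x)) < 0 :=
    hcont.continuousAt.eventually_lt continuousAt_const (by simpa using hgx)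
  obtain ⟨ε, hε, hball⟩ := Metric.eventually_nhds_iff.1 hev
  obtain ⟨t, ht0, ht⟩ := exists_between (lt_min hε one_pos)
  obtain ⟨htε, ht1⟩ := lt_min_iff.1 ht
  have hmem : ∀ i, (x + t • (a - x)) i ∈ Set.Icc (a i) (b i) := by
    intro i
    obtain ⟨h1, h2⟩ := hx i
    simp only [Pi.add_apply, Pi.smul_apply, Pi.sub_apply, smul_eq_mul]
    constructor <;> nlinarith
  refine ⟨x + t • (a - x), hmem,
    hball (by rwa [Real.dist_eq, sub_zero, abs_of_pos ht0]), ?_⟩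
  obtain ⟨j, hj⟩ := Function.ne_iff.1 hne
  refine Finset.sum_lt_sum (fun i _ => (hC i).monotoneOn (hmem i) (hx i) ?_)
    ⟨j, Finset.mem_univ j, hC j (hmem j) (hx j) ?_⟩
  · simp only [Pi.add_apply, Pi.smul_apply, Pi.sub_apply, smul_eq_mul]
    nlinarith [(hx i).1]
  · simp only [Pi.add_apply, Pi.smul_apply, Pi.sub_apply, smul_eq_mul]
    nlinarith [lt_of_le_of_ne (hx j).1 (Ne.symm hj)]

/-- Theorem 1, Relaxation: Under the standing assumptions
(strongly convex differentiable costs with nonnegative derivative on `X_i` and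
positive derivative on its interior, `B = RᵀR ⪰ 0`, Assumption A5, Slater), any
optimal solution `(x̄, ū)` of the relaxed EDP (5) makes the relaxed inequality
constraint active, and is therefore also an optimal solution of the
equality-constrained EDP obtained by replacing the inequality with equality. -/
theorem relaxed_edp_exact
    (n : ℕ)
    (xmin xmax d : Fin n → ℝ) (C : Fin n → ℝ → ℝ) (c : Fin n → ℝ)
    (B R : Matrix (Fin n) (Fin n) ℝ)
    (hBR : B = Rᵀ * R) (hBsym : B.IsSymm) (hBpsd : B.PosSemidef)
    (hxmin : ∀ i, 0 ≤ xmin i) (hxminmax : ∀ i, xmin i ≤ xmax i)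
    (hd : ∀ i, 0 ≤ d i)
    (hc : ∀ i, 0 < c i)
    (hCdiff : ∀ i, Differentiable ℝ (C i))
    (hCconv : ∀ i, StrongConvexOn Set.univ (c i) (C i))
    (hCderiv_nonneg : ∀ i, ∀ x ∈ Set.Icc (xmin i) (xmax i), 0 ≤ deriv (C i) x)
    (hCderiv_pos : ∀ i, ∀ x ∈ Set.Ioo (xmin i) (xmax i), 0 < deriv (C i) x)
    -- Assumption A5
    (hA51 : ∑ i, xmin i < ∑ i, d i + xmin ⬝ᵥ B.mulVec xmin)
    (hA52min : xmin ⬝ᵥ B.mulVec xmin ≤ ∑ i, xmin i)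
    (hA52max : xmax ⬝ᵥ B.mulVec xmax ≤ ∑ i, xmax i)
    -- Slater condition
    (hSlater : ∃ xt : Fin n → ℝ, (∀ i, xt i ∈ Set.Ioo (xmin i) (xmax i)) ∧
      xt ⬝ᵥ B.mulVec xt + ∑ i, d i - ∑ i, xt i = 0)
    -- (x̄, ū) optimal for the relaxed problem (5)
    (xb ub : Fin n → ℝ)
    (hfeas : (∀ i, xb i ∈ Set.Icc (xmin i) (xmax i)) ∧
      (∑ i, (ub i) ^ 2 + ∑ i, d i - ∑ i, xb i ≤ 0) ∧ R.mulVec xb = ub)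
    (hopt : ∀ x u : Fin n → ℝ,
      ((∀ i, x i ∈ Set.Icc (xmin i) (xmax i)) ∧
        (∑ i, (u i) ^ 2 + ∑ i, d i - ∑ i, x i ≤ 0) ∧ R.mulVec x = u) →
      ∑ i, C i (xb i) ≤ ∑ i, C i (x i)) :
    -- the inequality constraint is active at the optimum
    (∑ i, (ub i) ^ 2 + ∑ i, d i - ∑ i, xb i = 0) ∧
    -- hence (x̄, ū) is optimal for the equality-constrained problem
    ((∀ i, xb i ∈ Set.Icc (xmin i) (xmax i)) ∧
      (∑ i, (ub i) ^ 2 + ∑ i, d i - ∑ i, xb i = 0) ∧ R.mulVec xb = ub) ∧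
    (∀ x u : Fin n → ℝ,
      ((∀ i, x i ∈ Set.Icc (xmin i) (xmax i)) ∧
        (∑ i, (u i) ^ 2 + ∑ i, d i - ∑ i, x i = 0) ∧ R.mulVec x = u) →
      ∑ i, C i (xb i) ≤ ∑ i, C i (x i)) := by
  obtain ⟨hbox, hle, hu⟩ := hfeas
  have hmono : ∀ i, StrictMonoOn (C i) (Set.Icc (xmin i) (xmax i)) := fun i =>
    strictMonoOn_of_deriv_pos (convex_Icc _ _) (hCdiff i).continuous.continuousOn
      (by rw [interior_Icc]; exact hCderiv_pos i)
  have hactive : ∑ i, (ub i) ^ 2 + ∑ i, d i - ∑ i, xb i = 0 := by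
    by_contra hne
    have hlt := lt_of_le_of_ne hle hne
    subst hu
    have hxb : xb ≠ xmin := by
      rintro rfl
      rw [hBR, dotProduct_transpose_mul_self_mulVec] at hA51
      linarith
    obtain ⟨y, hy, hgy, hcost⟩ := exists_mem_box_sum_lt hmono hbox hxb
      (g := fun x => ∑ i, (R.mulVec x i) ^ 2 + ∑ i, d i - ∑ i, x i)
      (by simp only [Matrix.mulVec, dotProduct]; fun_prop) hlt
    exact (hopt y _ ⟨hy, hgy.le, rfl⟩).not_gt hcost
  exact ⟨hactive, ⟨hbox, hactive, hu⟩,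
    fun x u ⟨hx, heq, hRx⟩ => hopt x u ⟨hx, heq.le, hRx⟩⟩
end

section
/- There do not exist a point (x̄, ū) feasible for the relaxed EDP (5) together with multipliers λ̄ = 0, ξ̄ ∈ ℝⁿ, and σ̄_i ≥ 0, φ̄_i ≥ 0 (i ∈ V) satisfying the KKT conditions of (5): stationarity ∇C_i(x̄_i) − λ̄ + Σ_{j∈V} ξ̄^(j) r_{ji} + σ̄_i − φ̄_i = 0 and 2λ̄ū_i − ξ̄^(i) = 0 for every i ∈ V, together with complementary slackness σ̄_i(x̄_i − x_i^max) = 0 and φ̄_i(x_i^min − x̄_i) = 0 for every i ∈ V. Equivalently, every KKT multiplier λ̄ ≥ 0 associated with the inequality constraint of (5) satisfies λ̄ > 0. -/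
open Matrix Finset

/-- The first-order condition of a box-constrained problem with no other active force: if the cost is
strictly convex and strictly increasing inside the box, the point lies at the lower end. -/
lemma eq_lower_of_box_stationarity {f : ℝ → ℝ} {a b x s p : ℝ}
    (hf : Differentiable ℝ f) (hconv : StrictConvexOn ℝ Set.univ f)
    (hpos : ∀ y ∈ Set.Ioo a b, 0 < deriv f y) (hx : x ∈ Set.Icc a b) (hs : 0 ≤ s)
    (hstat : deriv f x + s - p = 0) (hp : p * (a - x) = 0) : x = a := by
  by_contra hne
  have hax : a < x := lt_of_le_of_ne hx.1 (Ne.symm hne)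
  have hp0 : p = 0 := (mul_eq_zero.mp hp).resolve_right (by linarith)
  have hmono : deriv f ((a + x) / 2) < deriv f x :=
    hconv.strictMonoOn_deriv (fun y _ => hf y) (Set.mem_univ _) (Set.mem_univ _) (by linarith)
  have hmid : 0 < deriv f ((a + x) / 2) := hpos _ ⟨by linarith, by linarith [hx.2]⟩
  linarith

/-- Under the standing assumptions (and Assumption A5), there is no
KKT point of the relaxed EDP (5) whose multiplier of the inequality constraint
is `λ̄ = 0`: no feasible `(x̄, ū)` together with `λ̄ = 0`, `ξ̄ ∈ ℝⁿ` and
nonnegative `σ̄, φ̄` can satisfy stationarity and complementary slackness.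
Equivalently, every KKT multiplier `λ̄ ≥ 0` of the inequality constraint is
strictly positive. -/
theorem no_kkt_with_zero_multiplier
    (n : ℕ)
    (xmin xmax d : Fin n → ℝ) (C : Fin n → ℝ → ℝ) (c : Fin n → ℝ)
    (B R : Matrix (Fin n) (Fin n) ℝ)
    (hBR : B = Rᵀ * R) (hBsym : B.IsSymm) (hBpsd : B.PosSemidef)
    (hxmin : ∀ i, 0 ≤ xmin i) (hxminmax : ∀ i, xmin i ≤ xmax i)
    (hd : ∀ i, 0 ≤ d i)
    (hc : ∀ i, 0 < c i)
    (hCdiff : ∀ i, Differentiable ℝ (C i))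
    (hCconv : ∀ i, StrongConvexOn Set.univ (c i) (C i))
    (hCderiv_nonneg : ∀ i, ∀ x ∈ Set.Icc (xmin i) (xmax i), 0 ≤ deriv (C i) x)
    (hCderiv_pos : ∀ i, ∀ x ∈ Set.Ioo (xmin i) (xmax i), 0 < deriv (C i) x)
    -- Assumption A5
    (hA51 : ∑ i, xmin i < ∑ i, d i + xmin ⬝ᵥ B.mulVec xmin)
    (hA52min : xmin ⬝ᵥ B.mulVec xmin ≤ ∑ i, xmin i)
    (hA52max : xmax ⬝ᵥ B.mulVec xmax ≤ ∑ i, xmax i) :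
    ¬ ∃ (xb ub : Fin n → ℝ) (lam : ℝ) (ξ σ φ : Fin n → ℝ),
      -- zero inequality multiplier
      lam = 0 ∧
      -- feasibility for the relaxed problem (5)
      (∀ i, xb i ∈ Set.Icc (xmin i) (xmax i)) ∧
      (∑ i, (ub i) ^ 2 + ∑ i, d i - ∑ i, xb i ≤ 0) ∧
      R.mulVec xb = ub ∧
      -- nonnegativity of the box-constraint multipliers
      (∀ i, 0 ≤ σ i) ∧ (∀ i, 0 ≤ φ i) ∧
      -- stationarity
      (∀ i, deriv (C i) (xb i) - lam + (∑ j, ξ j * R j i) + σ i - φ i = 0) ∧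
      (∀ i, 2 * lam * ub i - ξ i = 0) ∧
      -- complementary slackness
      (∀ i, σ i * (xb i - xmax i) = 0) ∧
      (∀ i, φ i * (xmin i - xb i) = 0) := by
  rintro ⟨xb, ub, lam, ξ, σ, φ, hlam, hx, hfeas, hRx, hσ, -, hstat, hξ, -, hφ⟩
  subst hlam hRx hBR
  have hξ0 : ∀ i, ξ i = 0 := fun i => by linarith [hξ i]
  have hxb : xb = xmin := funext fun i => by
    have hi := hstat i
    simp only [hξ0, zero_mul, sum_const_zero, sub_zero, add_zero] at hi
    exact eq_lower_of_box_stationarity (hCdiff i) ((hCconv i).strictConvexOn (hc i))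
      (hCderiv_pos i) (hx i) (hσ i) hi (hφ i)
  subst hxb
  have hloss : xb ⬝ᵥ (Rᵀ * R).mulVec xb = ∑ i, (R.mulVec xb i) ^ 2 := by
    rw [← mulVec_mulVec, dotProduct_mulVec, vecMul_transpose]
    simp only [dotProduct, sq]
  linarith
end

section
/- Suppose strong duality holds between problem (7) and its dual, with primal optimal solution (x̄, ū) (ū_i ∈ U for all i) and dual optimal pair (λ̄, ξ̄) with λ̄ ≥ 0, i.e., Σ_{i∈V} C_i(x̄_i) = Σ_{i∈V} inf_{x_i∈X_i,u_i∈U} L_i(x_i,u_i,λ̄,ξ̄). Let v_i(k) → λ̄ and w_i(k) → ξ̄ as k → ∞ for every i ∈ V, and for each k let (x_i(k+1), u_i(k+1)) be a minimizer of L_i(·,·,v_i(k),w_i(k)) over X_i × U. Then Σ_{i∈V} [ L_i(x̄_i, ū_i, λ̄, ξ̄) − L_i(x_i(k+1), u_i(k+1), λ̄, ξ̄) ] → 0 as k → ∞. -/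
open Matrix Finset Filter

/-- Local Lagrangian `L_i(x_i, u_i, λ, ξ) = C_i(x_i) + λ(u_i² + d_i − x_i)
+ ξ^(i)(r_{ii} x_i − u_i) + Σ_{j≠i} ξ^(j) r_{ji} x_i`. -/
noncomputable def localLagr {n : ℕ} (C : Fin n → ℝ → ℝ) (d : Fin n → ℝ)
    (R : Matrix (Fin n) (Fin n) ℝ) (i : Fin n) (x u lam : ℝ) (ξ : Fin n → ℝ) : ℝ :=
  C i x + lam * (u ^ 2 + d i - x) + ξ i * (R i i * x - u) +
    ∑ j ∈ Finset.univ.erase i, ξ j * (R j i * x)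

open Topology in
/-- If `x k ∈ K` minimizes `F (p k)` over the compact set `K` and `p k → q`, then the values of the
limiting function `F q` at `x k` converge to its minimum over `K`. -/
lemma IsCompact.tendsto_sInf_image_of_minimizers {P X ι : Type*} [TopologicalSpace P]
    [TopologicalSpace X] {K : Set X} (hK : IsCompact K) {F : P → X → ℝ}
    (hF : Continuous (Function.uncurry F)) {l : Filter ι} {p : ι → P} {q : P}
    (hp : Tendsto p l (𝓝 q)) {x : ι → X} (hx : ∀ k, x k ∈ K)
    (hmin : ∀ k, ∀ y ∈ K, F (p k) (x k) ≤ F (p k) y) :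
    Tendsto (fun k => F q (x k)) l (𝓝 (sInf (F q '' K))) := by
  have hval : ∀ k, sInf (F (p k) '' K) = F (p k) (x k) := fun k =>
    IsLeast.csInf_eq ⟨Set.mem_image_of_mem _ (hx k), Set.forall_mem_image.2 (hmin k)⟩
  have hinf : Tendsto (fun k => F (p k) (x k)) l (𝓝 (sInf (F q '' K))) := by
    simpa only [Function.comp_def, hval] using ((hK.continuous_sInf hF).tendsto q).comp hp
  have hdist : Tendsto (fun k => dist (F (p k) (x k)) (F q (x k))) l (𝓝 0) := by
    refine Metric.tendsto_nhds.2 fun ε hε => ?_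
    obtain ⟨v, hv, hvF⟩ := hK.mem_uniformity_of_prod (s := Set.univ) hF.continuousOn
      (Set.mem_univ q) (Metric.dist_mem_uniformity hε)
    rw [nhdsWithin_univ] at hv
    filter_upwards [hp hv] with k hk
    simpa using hvF _ hk _ (hx k)
  exact (tendsto_iff_of_dist hdist).1 hinf

lemma continuous_localLagr {n : ℕ} {C : Fin n → ℝ → ℝ} {i : Fin n} (hC : Continuous (C i))
    (d : Fin n → ℝ) (R : Matrix (Fin n) (Fin n) ℝ) :
    Continuous (Function.uncurry fun (q : ℝ × (Fin n → ℝ)) (p : ℝ × ℝ) =>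
      localLagr C d R i p.1 p.2 q.1 q.2) := by
  unfold localLagr Function.uncurry
  fun_prop

/-- When `u = R x`, the multipliers of the coupling constraint drop out of the total Lagrangian. -/
lemma sum_localLagr_mulVec {n : ℕ} (C : Fin n → ℝ → ℝ) (d : Fin n → ℝ)
    (R : Matrix (Fin n) (Fin n) ℝ) (x : Fin n → ℝ) (lam : ℝ) (ξ : Fin n → ℝ) :
    ∑ i, localLagr C d R i (x i) (R.mulVec x i) lam ξ =
      ∑ i, C i (x i) + lam * (∑ i, R.mulVec x i ^ 2 + ∑ i, d i - ∑ i, x i) := by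
  have hi : ∀ i, localLagr C d R i (x i) (R.mulVec x i) lam ξ =
      C i (x i) + lam * (R.mulVec x i ^ 2 + d i - x i) +
        (∑ j, ξ j * (R j i * x i) - ξ i * R.mulVec x i) := fun i => by
    rw [localLagr, ← Finset.add_sum_erase _ _ (Finset.mem_univ i)]
    ring
  have hswap : ∑ i, ∑ j, ξ j * (R j i * x i) = ∑ j, ξ j * R.mulVec x j := by
    rw [Finset.sum_comm]
    simp only [Matrix.mulVec, dotProduct, Finset.mul_sum]
  simp only [hi, Finset.sum_add_distrib, Finset.sum_sub_distrib, ← Finset.mul_sum, hswap]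
  ring

/-- Claim 1: If strong duality holds between problem (7) and its
dual at the primal optimum `(x̄, ū)` and dual optimum `(λ̄, ξ̄)`, and
`(v_i(k), w_i(k)) → (λ̄, ξ̄)` while `(x_i(k+1), u_i(k+1))` minimizes
`L_i(·,·,v_i(k),w_i(k))` over `X_i × U`, then
`Σ_i [L_i(x̄_i, ū_i, λ̄, ξ̄) − L_i(x_i(k+1), u_i(k+1), λ̄, ξ̄)] → 0`. -/
theorem claim1_lagrangian_gap_vanishes
    (n : ℕ) (hn : 0 < n)
    (xmin xmax d : Fin n → ℝ) (C : Fin n → ℝ → ℝ) (c : Fin n → ℝ)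
    (B R : Matrix (Fin n) (Fin n) ℝ)
    (hBR : B = Rᵀ * R) (hBsym : B.IsSymm) (hBpsd : B.PosSemidef)
    (hxmin : ∀ i, 0 ≤ xmin i) (hxminmax : ∀ i, xmin i ≤ xmax i)
    (hd : ∀ i, 0 ≤ d i)
    (hc : ∀ i, 0 < c i)
    (hCdiff : ∀ i, Differentiable ℝ (C i))
    (hCconv : ∀ i, StrongConvexOn Set.univ (c i) (C i))
    (hCderiv_nonneg : ∀ i, ∀ x ∈ Set.Icc (xmin i) (xmax i), 0 ≤ deriv (C i) x)
    (hCderiv_pos : ∀ i, ∀ x ∈ Set.Ioo (xmin i) (xmax i), 0 < deriv (C i) x)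
    -- the set U = [−u^max, u^max]
    (rmax : Fin n → ℝ)
    (hrmax : ∀ i, IsGreatest (Set.range fun j => |R j i|) (rmax i))
    (umax : ℝ) (humax : umax = ∑ i, rmax i * xmax i)
    -- (x̄, ū) primal optimal for problem (7)
    (xb ub : Fin n → ℝ)
    (hfeas : (∀ i, xb i ∈ Set.Icc (xmin i) (xmax i)) ∧
      (∑ i, (ub i) ^ 2 + ∑ i, d i - ∑ i, xb i ≤ 0) ∧
      R.mulVec xb = ub ∧ (∀ i, ub i ∈ Set.Icc (-umax) umax))
    (hopt : ∀ x u : Fin n → ℝ,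
      ((∀ i, x i ∈ Set.Icc (xmin i) (xmax i)) ∧
        (∑ i, (u i) ^ 2 + ∑ i, d i - ∑ i, x i ≤ 0) ∧
        R.mulVec x = u ∧ (∀ i, u i ∈ Set.Icc (-umax) umax)) →
      ∑ i, C i (xb i) ≤ ∑ i, C i (x i))
    -- dual optimal pair (λ̄, ξ̄) and strong duality
    (lam : ℝ) (hlam : 0 ≤ lam) (ξ : Fin n → ℝ)
    (hstrong : ∑ i, C i (xb i) =
      ∑ i, sInf ((fun p : ℝ × ℝ => localLagr C d R i p.1 p.2 lam ξ) ''
        (Set.Icc (xmin i) (xmax i) ×ˢ Set.Icc (-umax) umax)))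
    -- the sequences v_i(k) → λ̄ and w_i(k) → ξ̄
    (v : Fin n → ℕ → ℝ) (w : Fin n → ℕ → Fin n → ℝ)
    (hv : ∀ i, Tendsto (v i) atTop (nhds lam))
    (hw : ∀ i, Tendsto (w i) atTop (nhds ξ))
    -- (x_i(k+1), u_i(k+1)) minimizes L_i(·, ·, v_i(k), w_i(k)) over X_i × U
    (xs us : Fin n → ℕ → ℝ)
    (hmin : ∀ i k,
      xs i (k + 1) ∈ Set.Icc (xmin i) (xmax i) ∧
      us i (k + 1) ∈ Set.Icc (-umax) umax ∧
      ∀ x ∈ Set.Icc (xmin i) (xmax i), ∀ u ∈ Set.Icc (-umax) umax,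
        localLagr C d R i (xs i (k + 1)) (us i (k + 1)) (v i k) (w i k) ≤
          localLagr C d R i x u (v i k) (w i k)) :
    Tendsto (fun k => ∑ i,
        (localLagr C d R i (xb i) (ub i) lam ξ -
          localLagr C d R i (xs i (k + 1)) (us i (k + 1)) lam ξ))
      atTop (nhds 0) := by
  obtain ⟨hx, hg, rfl, hu⟩ := hfeas
  have hCcont : ∀ i, Continuous (C i) := fun i => (hCdiff i).continuous
  have hK : ∀ i, IsCompact (Set.Icc (xmin i) (xmax i) ×ˢ Set.Icc (-umax) umax) :=
    fun i => isCompact_Icc.prod isCompact_Icc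
  have hlower : ∑ i, sInf ((fun p : ℝ × ℝ => localLagr C d R i p.1 p.2 lam ξ) ''
        (Set.Icc (xmin i) (xmax i) ×ˢ Set.Icc (-umax) umax)) ≤
      ∑ i, localLagr C d R i (xb i) (R.mulVec xb i) lam ξ := by
    refine Finset.sum_le_sum fun i _ => csInf_le ?_ ?_
    · exact (hK i).bddBelow_image
        ((continuous_localLagr (hCcont i) d R).comp (Continuous.prodMk_right (lam, ξ))).continuousOn
    · exact Set.mem_image_of_mem (fun p : ℝ × ℝ => localLagr C d R i p.1 p.2 lam ξ)
        (Set.mk_mem_prod (hx i) (hu i))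
  have hupper := sum_localLagr_mulVec C d R xb lam ξ
  have hslack := mul_nonpos_of_nonneg_of_nonpos hlam hg
  have heq : ∑ i, localLagr C d R i (xb i) (R.mulVec xb i) lam ξ =
      ∑ i, sInf ((fun p : ℝ × ℝ => localLagr C d R i p.1 p.2 lam ξ) ''
        (Set.Icc (xmin i) (xmax i) ×ˢ Set.Icc (-umax) umax)) := by
    linarith
  have hlim := tendsto_finsetSum Finset.univ fun i _ =>
    (hK i).tendsto_sInf_image_of_minimizers (continuous_localLagr (hCcont i) d R)
      ((hv i).prodMk_nhds (hw i)) (x := fun k => (xs i (k + 1), us i (k + 1)))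
      (fun k => Set.mk_mem_prod (hmin i k).1 (hmin i k).2.1)
      (fun k y hy => (hmin i k).2.2 y.1 hy.1 y.2 hy.2)
  simp only [Finset.sum_sub_distrib, heq]
  simpa using hlim.const_sub (∑ i, sInf ((fun p : ℝ × ℝ => localLagr C d R i p.1 p.2 lam ξ) ''
    (Set.Icc (xmin i) (xmax i) ×ˢ Set.Icc (-umax) umax)))
end

section
/- Suppose the communication graph G is undirected and connected, each D_i (i ∈ V\M) is strongly convex, Assumption 8 holds (Σ_{i∈V} y_i^max > Σ_{i∈V} s_i = y_tot), A = [a_{ij}] is doubly stochastic with a_{ii} > 0 and, for i ≠ j, a_{ij} > 0 if and only if j ∈ N_i, and the step sizes α(k) > 0 satisfy Σ_{k=0}^∞ α(k) = ∞ and Σ_{k=0}^∞ α(k)² < ∞. Consider the sequences: (z_i(k+1), y_i(k+1)) a minimizer over Z_i × Y_i (respectively Y_i alone for i ∈ V\M) of L_i^ls(·,·,φ_i(k)); η_i(k+1) = φ_i(k) + α(k) g_i(z_i(k+1), y_i(k+1)) ∈ ℝ^{m+1}; φ_i(k+1) = Σ_{j∈V} a_{ij} η_j(k+1). Then there exists a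 dual optimal η̄ ∈ ℝ^{m+1} of the dual of problem (20) such that for every i ∈ V, η_i(k) → η̄ and (z_i(k), y_i(k)) → (z̄_i, ȳ_i), the (unique) optimal solution of problem (20), as k → ∞. -/
open Finset Filter

/-- Constraint functions `g_i^(ν)` of the priority-considered load shedding
problem (20), for `ν = 1, …, m+1`.  Priorities are encoded by `p : Fin n → ℕ`
with `p i = ℓ ≥ 1` iff `i ∈ M_ℓ` and `p i = 0` iff `i ∈ V\M`. -/
noncomputable def gLS (n m : ℕ) (p : Fin n → ℕ) (s : Fin n → ℝ)
    (i : Fin n) (z y : ℝ) (ν : ℕ) : ℝ :=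
  if m = 0 then s i - y
  else if ν = 1 then (if p i = 1 then s i - y - z else s i)
  else if ν = m + 1 then (if p i = m then z else if p i = 0 then -y else 0)
  else if p i = ν then -y - z
  else if p i = ν - 1 then z
  else 0

/-- Local objective of problem (20): `F_i = D_i(y_i) − r_i y_i` for regular
buses (`p i = 0`) and `F_i = κ z_i² + (y_i − n s_i / p_i)²` for prioritized
buses. -/
noncomputable def Fls (n : ℕ) (p : Fin n → ℕ) (s : Fin n → ℝ)
    (D : Fin n → ℝ → ℝ) (r : Fin n → ℝ) (κ : ℝ) (i : Fin n) (z y : ℝ) : ℝ :=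
  if p i = 0 then D i y - r i * y
  else κ * z ^ 2 + (y - (n : ℝ) * s i / (p i : ℝ)) ^ 2

/-- Local Lagrangian `L_i^{ls}(y_i, z_i, η) = F_i(z_i, y_i)
+ Σ_{ν=1}^{m+1} η^(ν) g_i^(ν)(z_i, y_i)`. -/
noncomputable def Lls (n m : ℕ) (p : Fin n → ℕ) (s : Fin n → ℝ)
    (D : Fin n → ℝ → ℝ) (r : Fin n → ℝ) (κ : ℝ) (i : Fin n) (z y : ℝ)
    (η : Fin (m + 1) → ℝ) : ℝ :=
  Fls n p s D r κ i z y + ∑ ν : Fin (m + 1), η ν * gLS n m p s i z y (ν.val + 1)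

/-- Local feasible set for the variables of agent `i`: `Z_i × Y_i` for a
prioritized bus and `{0} × Y_i` (only `y_i` is a variable) for a regular bus. -/
noncomputable def boxLS (n : ℕ) (p : Fin n → ℕ) (s ymax : Fin n → ℝ)
    (i : Fin n) : Set (ℝ × ℝ) :=
  (if p i = 0 then ({0} : Set ℝ) else Set.Icc 0 ((n : ℝ) * s i)) ×ˢ
    Set.Icc 0 (ymax i)

/-- Feasibility for problem (20): box constraints together with the `m + 1`
equality constraints `Σ_i g_i^(ν)(z_i, y_i) = 0`. -/
def Feas20 (n m : ℕ) (p : Fin n → ℕ) (s ymax : Fin n → ℝ)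
    (z y : Fin n → ℝ) : Prop :=
  (∀ i, y i ∈ Set.Icc 0 (ymax i)) ∧
  (∀ i, p i ≠ 0 → z i ∈ Set.Icc 0 ((n : ℝ) * s i)) ∧
  (∀ i, p i = 0 → z i = 0) ∧
  (∀ ν : Fin (m + 1), ∑ i, gLS n m p s i (z i) (y i) (ν.val + 1) = 0)

section Scalar

/-- A nonnegative sequence contracted at each step up to a summable error is summable. -/
lemma summable_of_contraction {u b : ℕ → ℝ} {ρ : ℝ} (hρ : ρ < 1)
    (hu : ∀ k, 0 ≤ u k) (hb : ∀ k, 0 ≤ b k) (hbs : Summable b)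
    (h : ∀ k, u (k + 1) ≤ ρ * u k + b k) : Summable u := by
  refine summable_of_sum_range_le (c := (u 0 + ∑' k, b k) / (1 - ρ)) hu fun N => ?_
  rw [le_div_iff₀ (by linarith)]
  have h1 : ∑ k ∈ range N, u (k + 1) ≤ ρ * ∑ k ∈ range N, u k + ∑ k ∈ range N, b k := by
    rw [mul_sum, ← sum_add_distrib]
    exact sum_le_sum fun k _ => h k
  have h2 : ∑ k ∈ range N, b k ≤ ∑' k, b k := hbs.sum_le_tsum _ fun k _ => hb k
  have h3 := sum_range_succ' u N
  have h4 := sum_range_succ u N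
  linarith [hu N]

/-- Deterministic Robbins–Siegmund lemma. -/
lemma robbins_siegmund {V a b : ℕ → ℝ} (hV : ∀ k, 0 ≤ V k) (ha : ∀ k, 0 ≤ a k)
    (hb : ∀ k, 0 ≤ b k) (hbs : Summable b) (h : ∀ k, V (k + 1) + a k ≤ V k + b k) :
    Summable a ∧ ∃ l, Tendsto V atTop (nhds l) := by
  have hbN : ∀ N, ∑ k ∈ range N, b k ≤ ∑' k, b k := fun N => hbs.sum_le_tsum _ fun k _ => hb k
  constructor
  · refine summable_of_sum_range_le (c := V 0 + ∑' k, b k) ha fun N => ?_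
    have h1 : V N + ∑ k ∈ range N, a k ≤ V 0 + ∑ k ∈ range N, b k := by
      induction N with
      | zero => simp
      | succ N ih => rw [sum_range_succ, sum_range_succ]; linarith [h N]
    linarith [hV N, hbN N]
  · have hanti : Antitone fun N => V N - ∑ k ∈ range N, b k := by
      refine antitone_nat_of_succ_le fun N => ?_
      rw [sum_range_succ]
      linarith [h N, ha N]
    have hbdd : BddBelow (Set.range fun N => V N - ∑ k ∈ range N, b k) := by
      refine ⟨-∑' k, b k, ?_⟩
      rintro _ ⟨N, rfl⟩
      linarith [hV N, hbN N]
    refine ⟨_, ((tendsto_atTop_ciInf hanti hbdd).add hbs.hasSum.tendsto_sum_nat).congr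
      fun N => by ring⟩

/-- If `∑ α k * e k` converges while `∑ α k` diverges, then `e` vanishes along a subsequence. -/
lemma exists_subseq_tendsto_zero {α e : ℕ → ℝ} (hα : ∀ k, 0 ≤ α k) (hαdiv : ¬ Summable α)
    (he : ∀ k, 0 ≤ e k) (hs : Summable fun k => α k * e k) :
    ∃ ψ : ℕ → ℕ, StrictMono ψ ∧ Tendsto (e ∘ ψ) atTop (nhds 0) := by
  have key : ∀ N : ℕ, ∃ᶠ k in atTop, e k < 1 / ((N : ℝ) + 1) := by
    intro N
    by_contra hcon
    rw [not_frequently, eventually_atTop] at hcon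
    obtain ⟨M, hM⟩ := hcon
    refine hαdiv ((summable_nat_add_iff M).1 ?_)
    refine Summable.of_nonneg_of_le (fun k => hα _) (fun k => ?_)
      (((summable_nat_add_iff M).2 hs).mul_left ((N : ℝ) + 1))
    have h1 := not_lt.1 (hM (k + M) (by omega))
    rw [div_le_iff₀ (by positivity)] at h1
    nlinarith [hα (k + M)]
  obtain ⟨ψ, hψ, h⟩ := extraction_forall_of_frequently key
  exact ⟨ψ, hψ, squeeze_zero (fun k => he _) (fun k => (h k).le)
    tendsto_one_div_add_atTop_nhds_zero_nat⟩

end Scalar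

section Consensus

variable {ι H : Type*} [Fintype ι] [NormedAddCommGroup H] [InnerProductSpace ℝ H]

lemma sum_mul_norm_sub_sq (a : ι → ℝ) (ha : ∑ j, a j = 1) (x : ι → H) :
    ∑ j, a j * ‖x j - ∑ l, a l • x l‖ ^ 2 =
      ∑ j, a j * ‖x j‖ ^ 2 - ‖∑ j, a j • x j‖ ^ 2 := by
  set v := ∑ l, a l • x l with hv
  have h1 : ∑ j, a j * inner ℝ (x j) v = ‖v‖ ^ 2 := by
    rw [← real_inner_self_eq_norm_sq]
    nth_rewrite 2 [hv]
    simp [sum_inner, real_inner_smul_left]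
  have h2 : ∀ j, a j * ‖x j - v‖ ^ 2 =
      a j * ‖x j‖ ^ 2 - 2 * (a j * inner ℝ (x j) v) + a j * ‖v‖ ^ 2 := fun j => by
    rw [norm_sub_sq_real]; ring
  simp_rw [h2, sum_add_distrib, sum_sub_distrib, ← mul_sum, ← sum_mul, ha, h1]
  ring

/-- Mixing by a doubly stochastic matrix loses exactly the weighted local variances. -/
lemma sum_norm_sq_mix (A : Matrix ι ι ℝ) (hArow : ∀ i, ∑ j, A i j = 1)
    (hAcol : ∀ j, ∑ i, A i j = 1) (x : ι → H) :
    ∑ i, ‖∑ j, A i j • x j‖ ^ 2 + ∑ i, ∑ j, A i j * ‖x j - ∑ l, A i l • x l‖ ^ 2 =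
      ∑ j, ‖x j‖ ^ 2 := by
  simp_rw [fun i => sum_mul_norm_sub_sq (A i) (hArow i) x]
  rw [sum_sub_distrib, sum_comm (f := fun i j => A i j * ‖x j‖ ^ 2)]
  simp_rw [← sum_mul, hAcol]
  simp

lemma sum_norm_sq_mix_le (A : Matrix ι ι ℝ) (hA : ∀ i j, 0 ≤ A i j)
    (hArow : ∀ i, ∑ j, A i j = 1) (hAcol : ∀ j, ∑ i, A i j = 1) (x : ι → H) :
    ∑ i, ‖∑ j, A i j • x j‖ ^ 2 ≤ ∑ j, ‖x j‖ ^ 2 := by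
  have h := sum_norm_sq_mix A hArow hAcol x
  have : 0 ≤ ∑ i, ∑ j, A i j * ‖x j - ∑ l, A i l • x l‖ ^ 2 :=
    sum_nonneg fun i _ => sum_nonneg fun j _ => mul_nonneg (hA i j) (sq_nonneg _)
  linarith

/-- Strict decrease on nonzero vectors with zero mean, for a connected communication graph. -/
lemma sum_norm_sq_mix_lt [DecidableEq ι] (G : SimpleGraph ι) (hG : G.Connected)
    (A : Matrix ι ι ℝ) (hA : ∀ i j, 0 ≤ A i j)
    (hArow : ∀ i, ∑ j, A i j = 1) (hAcol : ∀ j, ∑ i, A i j = 1) (hAdiag : ∀ i, 0 < A i i)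
    (hAadj : ∀ i j, G.Adj i j → 0 < A i j) (x : ι → H) (hx : ∑ i, x i = 0)
    (hx1 : ∑ i, ‖x i‖ ^ 2 ≠ 0) :
    ∑ i, ‖∑ j, A i j • x j‖ ^ 2 < ∑ j, ‖x j‖ ^ 2 := by
  refine lt_of_le_of_ne (sum_norm_sq_mix_le A hA hArow hAcol x) fun heq => hx1 ?_
  have h := sum_norm_sq_mix A hArow hAcol x
  have h0 : ∑ i, ∑ j, A i j * ‖x j - ∑ l, A i l • x l‖ ^ 2 = 0 := by linarith
  have hnn : ∀ i j, 0 ≤ A i j * ‖x j - ∑ l, A i l • x l‖ ^ 2 :=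
    fun i j => mul_nonneg (hA i j) (sq_nonneg _)
  have h1 : ∀ i j, A i j * ‖x j - ∑ l, A i l • x l‖ ^ 2 = 0 := fun i j =>
    (sum_eq_zero_iff_of_nonneg fun j _ => hnn i j).1
      ((sum_eq_zero_iff_of_nonneg fun i _ => sum_nonneg fun j _ => hnn i j).1 h0 i (mem_univ i))
      j (mem_univ j)
  have h2 : ∀ i j, 0 < A i j → x j = ∑ l, A i l • x l := fun i j hij => by
    rcases mul_eq_zero.1 (h1 i j) with h | h
    · exact absurd h hij.ne'
    · exact sub_eq_zero.1 (norm_eq_zero.1 (pow_eq_zero_iff two_ne_zero |>.1 h))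
  have h3 : ∀ i j, G.Adj i j → x i = x j := fun i j hij =>
    (h2 i i (hAdiag i)).trans (h2 i j (hAadj i j hij)).symm
  have h4 : ∀ i j, x i = x j := fun i j => by
    obtain ⟨w⟩ := hG.preconnected i j
    induction w with
    | nil => rfl
    | cons hadj _ ih => exact (h3 _ _ hadj).trans ih
  have := hG.nonempty
  refine sum_eq_zero fun i _ => ?_
  have h5 : (Fintype.card ι : ℝ) • x i = 0 := by
    rw [← hx, sum_congr rfl fun j _ => h4 j i]
    simp [Nat.cast_smul_eq_nsmul]
  have h6 : x i = 0 := (smul_eq_zero.1 h5).resolve_left (by simp)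
  simp [h6]

/-- Uniform contraction of the disagreement under mixing. -/
lemma exists_mix_contraction [FiniteDimensional ℝ H] [DecidableEq ι] (G : SimpleGraph ι)
    (hG : G.Connected) (A : Matrix ι ι ℝ) (hA : ∀ i j, 0 ≤ A i j)
    (hArow : ∀ i, ∑ j, A i j = 1) (hAcol : ∀ j, ∑ i, A i j = 1) (hAdiag : ∀ i, 0 < A i i)
    (hAadj : ∀ i j, G.Adj i j → 0 < A i j) :
    ∃ ρ : ℝ, 0 ≤ ρ ∧ ρ < 1 ∧ ∀ x : ι → H, ∑ i, x i = 0 →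
      ∑ i, ‖∑ j, A i j • x j‖ ^ 2 ≤ ρ * ∑ i, ‖x i‖ ^ 2 := by
  set S : Set (ι → H) := {x | ∑ i, x i = 0 ∧ ∑ i, ‖x i‖ ^ 2 = 1} with hS
  have hcl : IsClosed S :=
    (isClosed_eq (by fun_prop) continuous_const).inter (isClosed_eq (by fun_prop) continuous_const)
  have hbd : S ⊆ Metric.closedBall 0 1 := fun x hx => by
    rw [mem_closedBall_zero_iff, pi_norm_le_iff_of_nonneg zero_le_one]
    intro i
    have : ‖x i‖ ^ 2 ≤ 1 := hx.2 ▸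
      single_le_sum (f := fun i => ‖x i‖ ^ 2) (fun i _ => sq_nonneg _) (mem_univ i)
    nlinarith [norm_nonneg (x i)]
  have : ProperSpace H := FiniteDimensional.proper_real H
  have hcomp : IsCompact S := (isCompact_closedBall 0 1).of_isClosed_subset hcl hbd
  have hscale : ∀ x : ι → H, ∑ i, x i = 0 → ∑ i, ‖x i‖ ^ 2 ≠ 0 →
      ∃ t : ℝ, t ^ 2 * ∑ i, ‖x i‖ ^ 2 = 1 ∧ (fun i => t • x i) ∈ S := fun x hx hx1 => by
    have hpos : 0 < ∑ i, ‖x i‖ ^ 2 :=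
      lt_of_le_of_ne (sum_nonneg fun i _ => sq_nonneg _) hx1.symm
    have ht : (√(∑ i, ‖x i‖ ^ 2))⁻¹ ^ 2 * ∑ i, ‖x i‖ ^ 2 = 1 := by
      rw [inv_pow, Real.sq_sqrt hpos.le, inv_mul_cancel₀ hx1]
    refine ⟨_, ht, ?_, ?_⟩
    · simp only [← smul_sum, hx, smul_zero]
    · simp only [norm_smul, mul_pow, ← mul_sum, Real.norm_eq_abs, sq_abs]
      exact ht
  rcases S.eq_empty_or_nonempty with hempty | hne
  · refine ⟨0, le_rfl, one_pos, fun x hx => ?_⟩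
    have h0 : ∑ i, ‖x i‖ ^ 2 = 0 := by
      by_contra hx1
      obtain ⟨t, -, ht⟩ := hscale x hx hx1
      simp [hempty] at ht
    have := sum_norm_sq_mix_le A hA hArow hAcol x
    linarith
  · obtain ⟨x₀, hx₀, hmax⟩ := hcomp.exists_isMaxOn hne
      (f := fun x : ι → H => ∑ i, ‖∑ j, A i j • x j‖ ^ 2) (by fun_prop)
    refine ⟨∑ i, ‖∑ j, A i j • x₀ j‖ ^ 2, sum_nonneg fun i _ => sq_nonneg _, ?_, fun x hx => ?_⟩
    · rw [← hx₀.2]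
      exact sum_norm_sq_mix_lt G hG A hA hArow hAcol hAdiag hAadj x₀ hx₀.1 (by simp [hx₀.2])
    · by_cases hx1 : ∑ i, ‖x i‖ ^ 2 = 0
      · have := sum_norm_sq_mix_le A hA hArow hAcol x
        rw [hx1, mul_zero]; linarith
      · obtain ⟨t, ht, htS⟩ := hscale x hx hx1
        have h1 : ∑ i, ‖∑ j, A i j • t • x j‖ ^ 2 = t ^ 2 * ∑ i, ‖∑ j, A i j • x j‖ ^ 2 := by
          simp_rw [smul_comm _ t, ← smul_sum, norm_smul, mul_pow, ← mul_sum, Real.norm_eq_abs,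
            sq_abs]
        have h2 := hmax htS
        simp only [Set.mem_ofPred_eq, h1] at h2
        have hpos : 0 ≤ ∑ i, ‖x i‖ ^ 2 := sum_nonneg fun i _ => sq_nonneg _
        calc ∑ i, ‖∑ j, A i j • x j‖ ^ 2
            = (t ^ 2 * ∑ i, ‖∑ j, A i j • x j‖ ^ 2) * ∑ i, ‖x i‖ ^ 2 := by
              linear_combination -(∑ i, ‖∑ j, A i j • x j‖ ^ 2) * ht
          _ ≤ _ := mul_le_mul_of_nonneg_right h2 hpos

end Consensus

section Duality

variable {E H : Type*} [NormedAddCommGroup H] [InnerProductSpace ℝ H]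

/-- The Lagrangian `F w + ⟪η, g w⟫`. -/
noncomputable def lagrangian (F : E → ℝ) (g : E → H) (w : E) (η : H) : ℝ :=
  F w + inner ℝ η (g w)

/-- `w` minimizes the Lagrangian with multiplier `η` over `K`. -/
def IsLagrangianMin (K : Set E) (F : E → ℝ) (g : E → H) (η : H) (w : E) : Prop :=
  w ∈ K ∧ ∀ w' ∈ K, lagrangian F g w η ≤ lagrangian F g w' η

lemma IsLagrangianMin.sInf_eq {K : Set E} {F : E → ℝ} {g : E → H} {η : H} {w : E}
    (h : IsLagrangianMin K F g η w) :
    sInf ((fun w => lagrangian F g w η) '' K) = lagrangian F g w η :=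
  IsLeast.csInf_eq ⟨⟨w, h.1, rfl⟩, by rintro _ ⟨w', hw', rfl⟩; exact h.2 w' hw'⟩

variable {ι : Type*} [Fintype ι]

/-- Saddle points: feasible local minimizers sharing a common multiplier. -/
def IsSaddle (K : ι → Set E) (F : ι → E → ℝ) (g : ι → E → H) (η : H) (w : ι → E) : Prop :=
  (∀ i, IsLagrangianMin (K i) (F i) (g i) η (w i)) ∧ ∑ i, g i (w i) = 0

lemma sum_lagrangian_of_feasible {F : ι → E → ℝ} {g : ι → E → H} {w : ι → E}
    (hw : ∑ i, g i (w i) = 0) (η : H) :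
    ∑ i, lagrangian (F i) (g i) (w i) η = ∑ i, F i (w i) := by
  simp only [lagrangian, sum_add_distrib, ← inner_sum, hw, inner_zero_right, add_zero]

variable [MetricSpace E]

/-- Every Lagrangian grows at least quadratically away from its minimizers. -/
def HasQuadraticGrowth (c : ℝ) (K : Set E) (F : E → ℝ) (g : E → H) : Prop :=
  ∀ η w, IsLagrangianMin K F g η w → ∀ w' ∈ K,
    lagrangian F g w η + c * dist w w' ^ 2 ≤ lagrangian F g w' η

lemma HasQuadraticGrowth.inner_ge {c : ℝ} {K : Set E} {F : E → ℝ} {g : E → H}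
    (h : HasQuadraticGrowth c K F g) {η η' : H} {w w' : E} (hw : IsLagrangianMin K F g η w)
    (hw' : IsLagrangianMin K F g η' w') :
    2 * c * dist w w' ^ 2 ≤ inner ℝ (η - η') (g w' - g w) := by
  have h1 := h η w hw w' hw'.1
  have h2 := h η' w' hw' w hw.1
  rw [dist_comm w' w] at h2
  simp only [lagrangian] at h1 h2
  simp only [inner_sub_left, inner_sub_right]
  linarith

/-- Minimizers of Lagrangians depend continuously on the multiplier. -/
lemma HasQuadraticGrowth.tendsto {c : ℝ} (hc : 0 < c) {K : Set E} (hK : IsCompact K) {F : E → ℝ}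
    {g : E → H} (hg : Continuous g) (h : HasQuadraticGrowth c K F g) {η : ℕ → H} {η₀ : H}
    (hη : Tendsto η atTop (nhds η₀)) {w : ℕ → E} {w₀ : E}
    (hw : ∀ k, IsLagrangianMin K F g (η k) (w k)) (hw₀ : IsLagrangianMin K F g η₀ w₀) :
    Tendsto w atTop (nhds w₀) := by
  obtain ⟨B, hB⟩ := (hK.image hg).isBounded.exists_norm_le
  have hsq : Tendsto (fun k => dist (w k) w₀ ^ 2) atTop (nhds 0) := by
    have hz : Tendsto (fun k => ‖η k - η₀‖ * (2 * B) / (2 * c)) atTop (nhds 0) := by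
      have := (tendsto_iff_norm_sub_tendsto_zero.1 hη).mul_const (2 * B)
      simpa using this.div_const (2 * c)
    refine squeeze_zero (fun k => sq_nonneg _) (fun k => ?_) hz
    rw [le_div_iff₀ (by positivity), mul_comm]
    refine (h.inner_ge (hw k) hw₀).trans ((real_inner_le_norm _ _).trans ?_)
    refine mul_le_mul_of_nonneg_left ?_ (norm_nonneg _)
    refine (norm_sub_le _ _).trans ?_
    linarith [hB _ ⟨_, hw₀.1, rfl⟩, hB _ ⟨_, (hw k).1, rfl⟩]
  rw [tendsto_iff_dist_tendsto_zero]
  simpa [Real.sqrt_sq dist_nonneg] using hsq.sqrt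

lemma IsCompact.exists_isLagrangianMin {K : Set E} (hK : IsCompact K) (hne : K.Nonempty)
    {F : E → ℝ} {g : E → H} (hF : Continuous F) (hg : Continuous g) (η : H) :
    ∃ w, IsLagrangianMin K F g η w := by
  obtain ⟨w, hw, hmin⟩ := hK.exists_isMinOn hne (f := fun w => lagrangian F g w η)
    (by unfold lagrangian; fun_prop)
  exact ⟨w, hw, fun w' hw' => hmin hw'⟩

lemma IsSaddle.quadratic_growth {K : ι → Set E} {F : ι → E → ℝ} {g : ι → E → H} {η : H}
    {w : ι → E} (h : IsSaddle K F g η w) {c : ℝ}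
    (hgrow : ∀ i, HasQuadraticGrowth c (K i) (F i) (g i)) {w' : ι → E}
    (hw' : ∀ i, w' i ∈ K i) (hfeas : ∑ i, g i (w' i) = 0) :
    ∑ i, F i (w i) + c * ∑ i, dist (w i) (w' i) ^ 2 ≤ ∑ i, F i (w' i) := by
  rw [← sum_lagrangian_of_feasible h.2 η, ← sum_lagrangian_of_feasible hfeas η, mul_sum,
    ← sum_add_distrib]
  exact sum_le_sum fun i _ => hgrow i η _ (h.1 i) _ (hw' i)

/-- The multiplier of a saddle point is dual optimal. -/
lemma IsSaddle.dual_optimal {K : ι → Set E} {F : ι → E → ℝ} {g : ι → E → H} {η : H}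
    {w : ι → E} (h : IsSaddle K F g η w) (hK : ∀ i, IsCompact (K i))
    (hF : ∀ i, Continuous (F i)) (hg : ∀ i, Continuous (g i)) (η' : H) :
    ∑ i, sInf ((fun w => lagrangian (F i) (g i) w η') '' K i) ≤
      ∑ i, sInf ((fun w => lagrangian (F i) (g i) w η) '' K i) := by
  simp_rw [fun i => (h.1 i).sInf_eq]
  rw [sum_lagrangian_of_feasible h.2 η, ← sum_lagrangian_of_feasible h.2 η']
  refine sum_le_sum fun i _ => ?_
  obtain ⟨v, hv⟩ := (hK i).exists_isLagrangianMin ⟨_, (h.1 i).1⟩ (hF i) (hg i) η'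
  rw [hv.sInf_eq]
  exact hv.2 _ (h.1 i).1

/-- A coercive dual function has a maximizer, and the corresponding local minimizers form a
saddle point. -/
theorem exists_isSaddle_of_coercive [FiniteDimensional ℝ H] {K : ι → Set E} {F : ι → E → ℝ}
    {g : ι → E → H} (hK : ∀ i, IsCompact (K i)) (hne : ∀ i, (K i).Nonempty)
    (hF : ∀ i, Continuous (F i)) (hg : ∀ i, Continuous (g i)) {c : ℝ} (hc : 0 < c)
    (hgrow : ∀ i, HasQuadraticGrowth c (K i) (F i) (g i)) {ε C : ℝ} (hε : 0 < ε)
    (hcoer : ∀ η : H, ∃ w : ι → E, (∀ i, w i ∈ K i) ∧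
      ∑ i, lagrangian (F i) (g i) (w i) η ≤ C - ε * ‖η‖) :
    ∃ η w, IsSaddle K F g η w := by
  have : ProperSpace H := FiniteDimensional.proper_real H
  choose W hW using fun i η => (hK i).exists_isLagrangianMin (hne i) (hF i) (hg i) η
  set q : H → ℝ := fun η => ∑ i, sInf ((fun w => lagrangian (F i) (g i) w η) '' K i) with hq
  have hqW : ∀ η, q η = ∑ i, lagrangian (F i) (g i) (W i η) η := fun η => by
    simp only [hq, fun i => (hW i η).sInf_eq]
  have hqle : ∀ η (w : ι → E), (∀ i, w i ∈ K i) →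
      q η ≤ ∑ i, lagrangian (F i) (g i) (w i) η := fun η w hw => by
    rw [hqW]
    exact sum_le_sum fun i _ => (hW i η).2 _ (hw i)
  have hqc : Continuous q := by
    refine continuous_finsetSum _ fun i _ => ?_
    refine (hK i).continuous_sInf (f := fun η w => lagrangian (F i) (g i) w η) ?_
    have := hF i
    have := hg i
    simp only [Function.HasUncurry.uncurry, lagrangian, id]
    fun_prop
  obtain ⟨η, hmax⟩ : ∃ η, ∀ η', q η' ≤ q η := by
    refine hqc.exists_forall_ge' 0 ?_
    have hlim : Tendsto (fun η : H => ε * ‖η‖) (cocompact H) atTop :=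
      (tendsto_norm_cocompact_atTop).const_mul_atTop hε
    filter_upwards [hlim.eventually_ge_atTop (C - q 0)] with η hη
    obtain ⟨w, hw, hle⟩ := hcoer η
    linarith [hqle η w hw]
  refine ⟨η, fun i => W i η, fun i => hW i η, ?_⟩
  set v := ∑ i, g i (W i η) with hv
  set t : ℕ → ℝ := fun k => 1 / ((k : ℝ) + 1) with ht
  have htpos : ∀ k, 0 < t k := fun k => by positivity
  have ht0 : Tendsto t atTop (nhds 0) := tendsto_one_div_add_atTop_nhds_zero_nat
  set η' : ℕ → H := fun k => η + t k • v with hη'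
  have hη'lim : Tendsto η' atTop (nhds η) := by
    simpa using tendsto_const_nhds.add (ht0.smul_const v)
  have hineq : ∀ k, inner ℝ v (∑ i, g i (W i (η' k))) ≤ 0 := fun k => by
    have h1 := hmax (η' k)
    have h2 := hqle η (fun i => W i (η' k)) fun i => (hW i _).1
    rw [hqW] at h1
    have h3 : ∑ i, lagrangian (F i) (g i) (W i (η' k)) (η' k) =
        ∑ i, lagrangian (F i) (g i) (W i (η' k)) η +
          t k * inner ℝ v (∑ i, g i (W i (η' k))) := by
      simp only [hη', lagrangian, inner_add_left, real_inner_smul_left, inner_sum, mul_sum,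
        ← sum_add_distrib]
      exact sum_congr rfl fun i _ => by ring
    have h4 : t k * inner ℝ v (∑ i, g i (W i (η' k))) ≤ 0 := by linarith
    nlinarith [htpos k]
  have hWlim : ∀ i, Tendsto (fun k => W i (η' k)) atTop (nhds (W i η)) := fun i =>
    (hgrow i).tendsto hc (hK i) (hg i) hη'lim (fun k => hW i (η' k)) (hW i η)
  have hlim : Tendsto (fun k => inner ℝ v (∑ i, g i (W i (η' k)))) atTop (nhds (inner ℝ v v)) := by
    refine tendsto_const_nhds.inner (tendsto_finsetSum _ fun i _ => ?_)
    exact ((hg i).tendsto _).comp (hWlim i)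
  have hfin := le_of_tendsto' hlim hineq
  rw [real_inner_self_eq_norm_sq] at hfin
  have : ‖v‖ ^ 2 = 0 := le_antisymm hfin (sq_nonneg _)
  simpa using this

lemma hasQuadraticGrowth_of_midpoint {E : Type*} [NormedAddCommGroup E] [NormedSpace ℝ E]
    {c : ℝ} {K : Set E} (hK : Convex ℝ K) {F : E → ℝ} {g : E → H}
    (hF : ∀ w ∈ K, ∀ w' ∈ K,
      F ((1 / 2 : ℝ) • w + (1 / 2 : ℝ) • w') + c * dist w w' ^ 2 ≤ (F w + F w') / 2)
    (hg : ∀ w w', g ((1 / 2 : ℝ) • w + (1 / 2 : ℝ) • w') =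
      (1 / 2 : ℝ) • g w + (1 / 2 : ℝ) • g w') :
    HasQuadraticGrowth (2 * c) K F g := by
  intro η w hw w' hw'
  have hmid := hw.2 _ (hK hw.1 hw' (by norm_num : (0 : ℝ) ≤ 1 / 2)
    (by norm_num : (0 : ℝ) ≤ 1 / 2) (by norm_num))
  have h := hF w hw.1 w' hw'
  simp only [lagrangian, hg, inner_add_right, real_inner_smul_right] at hmid ⊢
  linarith

end Duality

section Convergence

variable {ι E H : Type*} [Fintype ι] [MetricSpace E] [NormedAddCommGroup H]
  [InnerProductSpace ℝ H]

/-- Convergence of the distributed dual subgradient method.  The iterate `w i k` is the local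
minimizer computed from the mixed multiplier `φ i k`. -/
theorem distributed_dual_subgradient_tendsto [FiniteDimensional ℝ H] [DecidableEq ι]
    (G : SimpleGraph ι) (hG : G.Connected)
    (A : Matrix ι ι ℝ) (hA : ∀ i j, 0 ≤ A i j)
    (hArow : ∀ i, ∑ j, A i j = 1) (hAcol : ∀ j, ∑ i, A i j = 1) (hAdiag : ∀ i, 0 < A i i)
    (hAadj : ∀ i j, G.Adj i j → 0 < A i j)
    {α : ℕ → ℝ} (hα : ∀ k, 0 < α k) (hαdiv : ¬ Summable α) (hαsq : Summable fun k => α k ^ 2)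
    {K : ι → Set E} {F : ι → E → ℝ} {g : ι → E → H}
    (hF : ∀ i, Continuous (F i)) (hg : ∀ i, Continuous (g i))
    (hK : ∀ i, IsCompact (K i)) {c : ℝ} (hc : 0 < c)
    (hgrow : ∀ i, HasQuadraticGrowth c (K i) (F i) (g i))
    {η₀ : H} {ws : ι → E} (hsad : IsSaddle K F g η₀ ws)
    {w : ι → ℕ → E} {φ : ι → ℕ → H}
    (hmin : ∀ i k, IsLagrangianMin (K i) (F i) (g i) (φ i k) (w i k))
    (hφ : ∀ i k, φ i (k + 1) = ∑ j, A i j • (φ j k + α k • g j (w j k))) :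
    ∃ ηb, IsSaddle K F g ηb ws ∧ (∀ i, Tendsto (φ i) atTop (nhds ηb)) ∧
      ∀ i, Tendsto (w i) atTop (nhds (ws i)) := by
  have hne := hG.nonempty
  have : ProperSpace H := FiniteDimensional.proper_real H
  set N : ℝ := (Fintype.card ι : ℝ) with hN
  have hNpos : 0 < N := by simp [hN, Fintype.card_pos]
  obtain ⟨B, hB0, hB⟩ : ∃ B : ℝ, 0 ≤ B ∧ ∀ i, ∀ v ∈ K i, ‖g i v‖ ≤ B := by
    choose b hb using fun i => ((hK i).image (hg i)).isBounded.exists_norm_le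
    refine ⟨∑ i, |b i|, sum_nonneg fun i _ => abs_nonneg _, fun i v hv => ?_⟩
    exact ((hb i _ ⟨v, hv, rfl⟩).trans (le_abs_self _)).trans
      (single_le_sum (f := fun i => |b i|) (fun i _ => abs_nonneg _) (mem_univ i))
  have hBw : ∀ i k, ‖g i (w i k)‖ ≤ B := fun i k => hB i _ (hmin i k).1
  -- disagreement
  set avg : (ι → H) → H := fun x => N⁻¹ • ∑ i, x i with havg
  have hdev : ∀ x : ι → H, ∑ i, (x i - avg x) = 0 := fun x => by
    have : (Fintype.card ι) • avg x = ∑ i, x i := by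
      rw [← Nat.cast_smul_eq_nsmul ℝ, ← hN, havg, smul_smul, mul_inv_cancel₀ hNpos.ne', one_smul]
    rw [sum_sub_distrib, sum_const, card_univ, this, sub_self]
  set u : ℕ → ℝ := fun k => ∑ i, ‖φ i k - avg fun j => φ j k‖ ^ 2 with hu
  have hu0 : ∀ k, 0 ≤ u k := fun k => sum_nonneg fun i _ => sq_nonneg _
  obtain ⟨ρ, hρ0, hρ1, hρ⟩ := exists_mix_contraction (H := H) G hG A hA hArow hAcol hAdiag hAadj
  have husum : Summable u := by
    set τ := 1 - ρ with hτ
    have hτpos : 0 < τ := by linarith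
    refine summable_of_contraction (ρ := ρ * (1 + τ))
      (b := fun k => ρ * (1 + τ⁻¹) * (N * (2 * B) ^ 2) * α k ^ 2) (by nlinarith) hu0
      (fun k => by positivity) (hαsq.mul_left _) fun k => ?_
    set X : ι → H := fun j => φ j k with hX
    set h : ι → H := fun j => g j (w j k) with hh
    set Y : ι → H := fun j => X j + α k • h j with hY
    have h1 : avg (fun i => φ i (k + 1)) = avg Y := by
      simp only [havg, hφ]
      rw [sum_comm]
      simp_rw [← sum_smul, hAcol, one_smul]
      rfl
    have h2 : ∀ i, φ i (k + 1) - avg (fun i => φ i (k + 1)) = ∑ j, A i j • (Y j - avg Y) :=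
      fun i => by
        rw [h1, hφ]
        simp_rw [smul_sub, sum_sub_distrib, ← sum_smul, hArow, one_smul]
        rfl
    have h3 : u (k + 1) ≤ ρ * ∑ j, ‖Y j - avg Y‖ ^ 2 := by
      simp only [hu, h2]
      exact hρ _ (hdev Y)
    have h4 : ∀ j, Y j - avg Y = (X j - avg X) + α k • (h j - avg h) := fun j => by
      simp only [hY, havg, sum_add_distrib, smul_add, smul_sub, ← smul_sum]
      rw [smul_comm (α k) N⁻¹]
      abel
    have havgh : ‖avg h‖ ≤ B := by
      simp only [havg, norm_smul, norm_inv, Real.norm_eq_abs, abs_of_pos hNpos]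
      rw [inv_mul_le_iff₀ hNpos]
      refine (norm_sum_le _ _).trans ((sum_le_sum fun i _ => hBw i k).trans ?_)
      simp [hN]
    have h5 : ∀ j, ‖Y j - avg Y‖ ^ 2 ≤
        (1 + τ) * ‖X j - avg X‖ ^ 2 + (1 + τ⁻¹) * (2 * B) ^ 2 * α k ^ 2 := fun j => by
      rw [h4]
      have e1 : ‖α k • (h j - avg h)‖ ≤ α k * (2 * B) := by
        rw [norm_smul, Real.norm_eq_abs, abs_of_pos (hα k)]
        refine mul_le_mul_of_nonneg_left ?_ (hα k).le
        exact (norm_sub_le _ _).trans (by linarith [hBw j k])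
      have e2 := norm_add_le (X j - avg X) (α k • (h j - avg h))
      set a := ‖X j - avg X‖
      set b := α k * (2 * B) with hb
      have hss : ‖X j - avg X + α k • (h j - avg h)‖ ^ 2 ≤ (a + b) ^ 2 :=
        pow_le_pow_left₀ (norm_nonneg _) (by linarith) 2
      have hab : 2 * a * b ≤ τ * a ^ 2 + τ⁻¹ * b ^ 2 := by
        have : 0 ≤ τ⁻¹ * (τ * a - b) ^ 2 := by positivity
        have e : τ⁻¹ * (τ * a - b) ^ 2 = τ * a ^ 2 - 2 * a * b + τ⁻¹ * b ^ 2 := by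
          field_simp
          ring
        linarith
      have : (1 + τ⁻¹) * (2 * B) ^ 2 * α k ^ 2 = (1 + τ⁻¹) * b ^ 2 := by rw [hb]; ring
      rw [this]
      nlinarith
    calc u (k + 1) ≤ ρ * ∑ j, ‖Y j - avg Y‖ ^ 2 := h3
      _ ≤ ρ * ∑ j, ((1 + τ) * ‖X j - avg X‖ ^ 2 + (1 + τ⁻¹) * (2 * B) ^ 2 * α k ^ 2) :=
          mul_le_mul_of_nonneg_left (sum_le_sum fun j _ => h5 j) hρ0
      _ = _ := by
          rw [sum_add_distrib, ← mul_sum, sum_const, card_univ, nsmul_eq_mul, ← hN]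
          simp only [hu, hX]
          ring
  have hdev0 : ∀ i, Tendsto (fun k => φ i k - avg fun j => φ j k) atTop (nhds 0) := fun i => by
    rw [tendsto_zero_iff_norm_tendsto_zero]
    have : Tendsto (fun k => ‖φ i k - avg fun j => φ j k‖ ^ 2) atTop (nhds 0) :=
      squeeze_zero (fun k => sq_nonneg _)
        (fun k => single_le_sum (f := fun i => ‖φ i k - avg fun j => φ j k‖ ^ 2)
          (fun i _ => sq_nonneg _) (mem_univ i)) husum.tendsto_atTop_zero
    simpa [Real.sqrt_sq (norm_nonneg _)] using this.sqrt
  -- descent with respect to an arbitrary saddle multiplier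
  set e : ℕ → ℝ := fun k => ∑ i, dist (w i k) (ws i) ^ 2 with he
  have he0 : ∀ k, 0 ≤ e k := fun k => sum_nonneg fun i _ => sq_nonneg _
  have hdesc : ∀ ηs, IsSaddle K F g ηs ws →
      (Summable fun k => 4 * c * (α k * e k)) ∧
        ∃ l, Tendsto (fun k => ∑ i, ‖φ i k - ηs‖ ^ 2) atTop (nhds l) := fun ηs hs => by
    refine robbins_siegmund (b := fun k => u k + 2 * N * B ^ 2 * α k ^ 2)
      (fun k => sum_nonneg fun i _ => sq_nonneg _)
      (fun k => mul_nonneg (by positivity) (mul_nonneg (hα k).le (he0 k)))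
      (fun k => add_nonneg (hu0 k) (by positivity)) (husum.add (hαsq.mul_left _)) fun k => ?_
    have h1 : ∑ i, ‖φ i (k + 1) - ηs‖ ^ 2 ≤ ∑ j, ‖φ j k + α k • g j (w j k) - ηs‖ ^ 2 := by
      refine le_trans (le_of_eq ?_) (sum_norm_sq_mix_le A hA hArow hAcol _)
      refine sum_congr rfl fun i _ => ?_
      rw [hφ]
      simp_rw [smul_sub, sum_sub_distrib, ← sum_smul, hArow, one_smul]
    have h2 : ∀ j, ‖φ j k + α k • g j (w j k) - ηs‖ ^ 2 ≤
        ‖φ j k - ηs‖ ^ 2 + 2 * α k * (inner ℝ (φ j k - ηs) (g j (ws j))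
          - 2 * c * dist (w j k) (ws j) ^ 2) + α k ^ 2 * B ^ 2 := fun j => by
      have e0 : φ j k + α k • g j (w j k) - ηs = (φ j k - ηs) + α k • g j (w j k) := by abel
      rw [e0, norm_add_sq_real, real_inner_smul_right, norm_smul, mul_pow, Real.norm_eq_abs,
        sq_abs]
      have e1 := (hgrow j).inner_ge (hmin j k) (hs.1 j)
      rw [inner_sub_right] at e1
      have e2 : ‖g j (w j k)‖ ^ 2 ≤ B ^ 2 := pow_le_pow_left₀ (norm_nonneg _) (hBw j k) 2
      have e3 := mul_le_mul_of_nonneg_left e2 (sq_nonneg (α k))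
      have e4 := mul_le_mul_of_nonneg_left e1 (hα k).le
      linarith
    have h3 : ∑ j, inner ℝ (φ j k - ηs) (g j (ws j)) =
        ∑ j, inner ℝ (φ j k - avg fun i => φ i k) (g j (ws j)) := by
      simp only [inner_sub_left, sum_sub_distrib, ← inner_sum, hs.2, inner_zero_right]
    have h4 : ∀ j, 2 * α k * inner ℝ (φ j k - avg fun i => φ i k) (g j (ws j)) ≤
        ‖φ j k - avg fun i => φ i k‖ ^ 2 + α k ^ 2 * B ^ 2 := fun j => by
      have e1 := real_inner_le_norm (φ j k - avg fun i => φ i k) (g j (ws j))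
      have e2 := hB j _ (hs.1 j).1
      have e3 := mul_le_mul_of_nonneg_left e2 (norm_nonneg (φ j k - avg fun i => φ i k))
      have e4 := mul_le_mul_of_nonneg_left (e1.trans e3) (hα k).le
      nlinarith [sq_nonneg (‖φ j k - avg fun i => φ i k‖ - α k * B)]
    have h5 : ∑ j, ‖φ j k + α k • g j (w j k) - ηs‖ ^ 2 ≤
        ∑ j, ‖φ j k - ηs‖ ^ 2 + (2 * α k * ∑ j, inner ℝ (φ j k - ηs) (g j (ws j))
          - 4 * c * (α k * e k)) + N * (α k ^ 2 * B ^ 2) := by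
      refine (sum_le_sum fun j _ => h2 j).trans (le_of_eq ?_)
      rw [sum_add_distrib, sum_add_distrib, ← mul_sum, sum_sub_distrib, ← mul_sum, sum_const,
        card_univ, nsmul_eq_mul, ← hN]
      ring
    have h6 : 2 * α k * ∑ j, inner ℝ (φ j k - ηs) (g j (ws j)) ≤
        u k + N * (α k ^ 2 * B ^ 2) := by
      rw [h3, mul_sum]
      refine (sum_le_sum fun j _ => h4 j).trans (le_of_eq ?_)
      rw [sum_add_distrib, sum_const, card_univ, nsmul_eq_mul, ← hN]
    linarith
  -- a cluster point of the multipliers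
  have hαe : Summable fun k => α k * e k :=
    (summable_mul_left_iff (by positivity : (4 * c) ≠ 0)).1 (hdesc η₀ hsad).1
  obtain ⟨ψ, hψ, hψe⟩ := exists_subseq_tendsto_zero (fun k => (hα k).le) hαdiv he0 hαe
  obtain ⟨l₀, hl₀⟩ := (hdesc η₀ hsad).2
  obtain ⟨M, hM⟩ := hl₀.bddAbove_range
  let i₀ : ι := Classical.arbitrary ι
  have hsingle : ∀ ηs i k, ‖φ i k - ηs‖ ^ 2 ≤ ∑ i, ‖φ i k - ηs‖ ^ 2 := fun ηs i k =>
    single_le_sum (f := fun i => ‖φ i k - ηs‖ ^ 2) (fun i _ => sq_nonneg _) (mem_univ i)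
  have hball : ∀ k, (φ i₀ ∘ ψ) k ∈ Metric.closedBall η₀ (√M) := fun k => by
    rw [mem_closedBall_iff_norm]
    exact Real.le_sqrt_of_sq_le ((hsingle η₀ i₀ (ψ k)).trans (hM ⟨ψ k, rfl⟩))
  obtain ⟨ηb, -, χ, hχ, hlim₀⟩ := tendsto_subseq_of_bounded Metric.isBounded_closedBall hball
  set θ := ψ ∘ χ with hθ
  have hθlim : Tendsto θ atTop atTop := (hψ.comp hχ).tendsto_atTop
  have hφθ : ∀ i, Tendsto (φ i ∘ θ) atTop (nhds ηb) := fun i => by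
    have h1 : Tendsto (fun k => φ i k - φ i₀ k) atTop (nhds 0) := by
      simpa using (hdev0 i).sub (hdev0 i₀)
    have h2 := (h1.comp hθlim).add hlim₀
    rw [zero_add] at h2
    exact h2.congr fun k => by simp [hθ]
  have hwθ : ∀ i, Tendsto (w i ∘ θ) atTop (nhds (ws i)) := fun i => by
    rw [tendsto_iff_dist_tendsto_zero]
    have : Tendsto (fun k => dist (w i (θ k)) (ws i) ^ 2) atTop (nhds 0) :=
      squeeze_zero (fun k => sq_nonneg _)
        (fun k => single_le_sum (f := fun i => dist (w i (θ k)) (ws i) ^ 2)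
          (fun i _ => sq_nonneg _) (mem_univ i)) (hψe.comp hχ.tendsto_atTop)
    simpa [Real.sqrt_sq dist_nonneg] using this.sqrt
  have hsadb : IsSaddle K F g ηb ws := by
    refine ⟨fun i => ⟨(hsad.1 i).1, fun v hv => ?_⟩, hsad.2⟩
    refine le_of_tendsto_of_tendsto' (b := atTop)
      (f := fun k => lagrangian (F i) (g i) (w i (θ k)) (φ i (θ k)))
      (g := fun k => lagrangian (F i) (g i) v (φ i (θ k))) ?_ ?_ fun k => (hmin i _).2 v hv
    · exact (((hF i).tendsto _).comp (hwθ i)).add ((hφθ i).inner (((hg i).tendsto _).comp (hwθ i)))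
    · exact tendsto_const_nhds.add ((hφθ i).inner tendsto_const_nhds)
  obtain ⟨l, hl⟩ := (hdesc ηb hsadb).2
  have hl0 : l = 0 := by
    refine tendsto_nhds_unique (f := fun k => ∑ i, ‖φ i (θ k) - ηb‖ ^ 2) (hl.comp hθlim) ?_
    have : Tendsto (fun k => ∑ i, ‖φ i (θ k) - ηb‖ ^ 2) atTop (nhds (∑ _i : ι, (0 : ℝ))) := by
      refine tendsto_finsetSum _ fun i _ => ?_
      simpa using (tendsto_iff_norm_sub_tendsto_zero.1 (hφθ i)).pow 2
    simpa using this
  have hφlim : ∀ i, Tendsto (fun k => ‖φ i k - ηb‖) atTop (nhds 0) := fun i => by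
    have : Tendsto (fun k => ‖φ i k - ηb‖ ^ 2) atTop (nhds 0) :=
      squeeze_zero (fun k => sq_nonneg _) (fun k => hsingle ηb i k) (hl0 ▸ hl)
    simpa [Real.sqrt_sq (norm_nonneg _)] using this.sqrt
  have hφb : ∀ i, Tendsto (φ i) atTop (nhds ηb) := fun i =>
    tendsto_iff_norm_sub_tendsto_zero.2 (hφlim i)
  exact ⟨ηb, hsadb, hφb, fun i => (hgrow i).tendsto hc (hK i) (hg i) (hφb i) (hmin i) (hsadb.1 i)⟩

end Convergence

section LoadShedding

/-- The constraint functions as a net outflow: a bus draws `y` from its node, and `z` moves from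
its node to the next one. -/
lemma gLS_succ_eq {n m : ℕ} {p : Fin n → ℕ} {s : Fin n → ℝ} {i : Fin n} (hp : p i ≤ m)
    (z y : ℝ) {ν : ℕ} (hν : ν ≤ m) :
    gLS n m p s i z y (ν + 1) = (if ν = 0 then s i else 0)
      - (if ν = (if p i = 0 then m else p i - 1) then y else 0)
      + ((if p i = ν ∧ p i ≠ 0 then z else 0) - (if p i = ν + 1 then z else 0)) := by
  unfold gLS
  grind

/-- The constraint vector as a map into Euclidean space. -/
noncomputable def gVec (n m : ℕ) (p : Fin n → ℕ) (s : Fin n → ℝ) (i : Fin n) (q : ℝ × ℝ) :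
    EuclideanSpace ℝ (Fin (m + 1)) :=
  WithLp.toLp 2 fun ν => gLS n m p s i q.1 q.2 (ν.val + 1)

/-- The local cost as a function of the pair `(z, y)`. -/
noncomputable def FPair (n : ℕ) (p : Fin n → ℕ) (s : Fin n → ℝ) (D : Fin n → ℝ → ℝ)
    (r : Fin n → ℝ) (κ : ℝ) (i : Fin n) (q : ℝ × ℝ) : ℝ :=
  Fls n p s D r κ i q.1 q.2

variable {n m : ℕ} {p : Fin n → ℕ} {s ymax r : Fin n → ℝ} {D : Fin n → ℝ → ℝ} {κ : ℝ}

lemma inner_gVec (i : Fin n) (q : ℝ × ℝ) (η : EuclideanSpace ℝ (Fin (m + 1))) :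
    inner ℝ η (gVec n m p s i q) = ∑ ν, η ν * gLS n m p s i q.1 q.2 (ν.val + 1) := by
  simp [gVec, PiLp.inner_apply, mul_comm]

lemma lagrangian_eq_Lls (i : Fin n) (q : ℝ × ℝ) (η : Fin (m + 1) → ℝ) :
    lagrangian (FPair n p s D r κ i) (gVec n m p s i) q (WithLp.toLp 2 η) =
      Lls n m p s D r κ i q.1 q.2 η := by
  simp [lagrangian, inner_gVec, Lls, FPair]

lemma continuous_gVec (i : Fin n) : Continuous (gVec n m p s i) := by
  refine (PiLp.continuous_toLp 2 _).comp (continuous_pi fun ν => ?_)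
  unfold gLS
  split_ifs <;> fun_prop

lemma gVec_midpoint (hp : ∀ i, p i ≤ m) (i : Fin n) (q q' : ℝ × ℝ) :
    gVec n m p s i ((1 / 2 : ℝ) • q + (1 / 2 : ℝ) • q') =
      (1 / 2 : ℝ) • gVec n m p s i q + (1 / 2 : ℝ) • gVec n m p s i q' := by
  ext ν
  simp only [gVec, PiLp.add_apply, PiLp.smul_apply, gLS_succ_eq (hp i) _ _ (Fin.is_le ν),
    Prod.fst_add, Prod.snd_add, Prod.smul_fst, Prod.smul_snd, smul_eq_mul]
  split_ifs <;> ring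

lemma sum_gVec_eq_zero_iff {w : Fin n → ℝ × ℝ} :
    ∑ i, gVec n m p s i (w i) = 0 ↔
      ∀ ν : Fin (m + 1), ∑ i, gLS n m p s i (w i).1 (w i).2 (ν.val + 1) = 0 := by
  rw [PiLp.ext_iff]
  simp [gVec]

lemma feas20_iff {z y : Fin n → ℝ} :
    Feas20 n m p s ymax z y ↔
      (∀ i, (z i, y i) ∈ boxLS n p s ymax i) ∧ ∑ i, gVec n m p s i (z i, y i) = 0 := by
  rw [sum_gVec_eq_zero_iff (w := fun i => (z i, y i))]
  unfold Feas20 boxLS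
  constructor
  · rintro ⟨h1, h2, h3, h4⟩
    refine ⟨fun i => ⟨?_, h1 i⟩, h4⟩
    by_cases h : p i = 0
    · simpa [h] using h3 i h
    · simpa [h] using h2 i h
  · rintro ⟨h1, h4⟩
    refine ⟨fun i => (h1 i).2, fun i h => ?_, fun i h => ?_, h4⟩
    · simpa [h] using (h1 i).1
    · simpa [h] using (h1 i).1

lemma isCompact_boxLS (i : Fin n) : IsCompact (boxLS n p s ymax i) := by
  unfold boxLS
  split_ifs
  · exact isCompact_singleton.prod isCompact_Icc
  · exact isCompact_Icc.prod isCompact_Icc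

lemma convex_boxLS (i : Fin n) : Convex ℝ (boxLS n p s ymax i) := by
  unfold boxLS
  split_ifs
  · exact (convex_singleton _).prod (convex_Icc _ _)
  · exact (convex_Icc _ _).prod (convex_Icc _ _)

lemma continuous_FPair {c : ℝ} (hc : 0 ≤ c) (i : Fin n)
    (hD : p i = 0 → StrongConvexOn Set.univ c (D i)) : Continuous (FPair n p s D r κ i) := by
  unfold FPair Fls
  split_ifs with h
  · have h1 : Continuous (D i) := by
      rw [← continuousOn_univ]
      refine ConvexOn.continuousOn isOpen_univ (UniformConvexOn.convexOn (hD h) fun t => ?_)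
      simp only [Pi.zero_apply]
      positivity
    fun_prop
  · fun_prop

lemma hasQuadraticGrowth_FPair (hp : ∀ i, p i ≤ m) (hκ : 1 ≤ κ) {c d : ℝ}
    (hc : c ≤ 1 / 4) (i : Fin n)
    (hD : p i = 0 → c ≤ d / 8 ∧ StrongConvexOn Set.univ d (D i)) :
    HasQuadraticGrowth (2 * c) (boxLS n p s ymax i) (FPair n p s D r κ i) (gVec n m p s i) := by
  refine hasQuadraticGrowth_of_midpoint (convex_boxLS i) ?_ (gVec_midpoint hp i)
  rintro ⟨a, b⟩ ⟨ha, hb⟩ ⟨a', b'⟩ ⟨ha', hb'⟩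
  simp only [FPair, Fls, Prod.fst_add, Prod.snd_add, Prod.smul_fst, Prod.smul_snd, smul_eq_mul]
  split_ifs with h
  · obtain ⟨hcd, hconv⟩ := hD h
    simp only [h, if_true, Set.mem_singleton_iff] at ha ha'
    subst ha ha'
    have h1 := hconv.2 (Set.mem_univ b) (Set.mem_univ b') (by norm_num : (0 : ℝ) ≤ 1 / 2)
      (by norm_num : (0 : ℝ) ≤ 1 / 2) (by norm_num)
    simp only [smul_eq_mul] at h1
    have h2 : dist ((0 : ℝ), b) ((0 : ℝ), b') = ‖b - b'‖ := by
      simp [Prod.dist_eq, Real.dist_eq]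
    rw [h2]
    nlinarith [mul_le_mul_of_nonneg_right hcd (sq_nonneg ‖b - b'‖)]
  · have h2 : dist (a, b) (a', b') ^ 2 ≤ (a - a') ^ 2 + (b - b') ^ 2 := by
      rw [Prod.dist_eq, Real.dist_eq, Real.dist_eq]
      rcases max_choice |a - a'| |b - b'| with h | h <;> simp only [h, sq_abs] <;>
        nlinarith [sq_nonneg (a - a'), sq_nonneg (b - b')]
    nlinarith [mul_le_mul_of_nonneg_right hc (sq_nonneg (dist (a, b) (a', b'))),
      mul_nonneg (sub_nonneg.2 hκ) (sq_nonneg (a - a'))]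

/-- A feasible point at which every `y` is strictly inside its range. -/
lemma exists_slater (hp : ∀ i, p i ≤ m) (hMne : ∀ ℓ, 1 ≤ ℓ → ℓ ≤ m → ∃ i, p i = ℓ)
    {ytot : ℝ} (hytot : 0 < ytot) (hs : ∀ i, (n : ℝ) * s i = ytot) (hymax : ∀ i, 0 < ymax i)
    (hsum : ∑ i, s i = ytot) (hlt : ytot < ∑ i, ymax i) :
    ∃ z y : Fin n → ℝ, (∀ i, (z i, y i) ∈ boxLS n p s ymax i) ∧
      (∀ i, 0 < y i ∧ y i < ymax i) ∧ ∑ i, gVec n m p s i (z i, y i) = 0 := by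
  set t := ytot / ∑ i, ymax i with ht
  have hS : 0 < ∑ i, ymax i := hytot.trans hlt
  have ht0 : 0 < t := div_pos hytot hS
  have ht1 : t < 1 := (div_lt_one hS).2 hlt
  set y : Fin n → ℝ := fun i => t * ymax i with hy
  have hy0 : ∀ i, 0 < y i := fun i => mul_pos ht0 (hymax i)
  have hy1 : ∀ i, y i < ymax i := fun i => by simp only [hy]; nlinarith [hymax i]
  have hysum : ∑ i, y i = ytot := by
    simp only [hy, ← mul_sum, ht]
    field_simp
  -- load passed on beyond priority level `ℓ`
  set R : ℕ → ℝ := fun ℓ => ytot - ∑ i with p i ≠ 0 ∧ p i ≤ ℓ, y i with hR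
  have hR0 : ∀ ℓ, 0 ≤ R ℓ := fun ℓ => by
    have : ∑ i with p i ≠ 0 ∧ p i ≤ ℓ, y i ≤ ∑ i, y i :=
      sum_le_sum_of_subset_of_nonneg (filter_subset _ _) fun i _ _ => (hy0 i).le
    simp only [hR]; linarith
  have hR1 : ∀ ℓ, R ℓ ≤ ytot := fun ℓ => by
    have : 0 ≤ ∑ i with p i ≠ 0 ∧ p i ≤ ℓ, y i := sum_nonneg fun i _ => (hy0 i).le
    simp only [hR]; linarith
  set z : Fin n → ℝ := fun i => if p i = 0 then 0 else R (p i) / #{j | p j = p i} with hz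
  have hcard : ∀ i, (1 : ℝ) ≤ #{j | p j = p i} := fun i => by
    exact_mod_cast card_pos.2 ⟨i, by simp⟩
  have hzsum : ∀ ℓ, 1 ≤ ℓ → ℓ ≤ m → ∑ i with p i = ℓ, z i = R ℓ := fun ℓ h1 h2 => by
    obtain ⟨i, hi⟩ := hMne ℓ h1 h2
    have : ∀ j ∈ ({j | p j = ℓ} : Finset (Fin n)), z j = R ℓ / #{j | p j = ℓ} := fun j hj => by
      have hj' : p j = ℓ := by simpa using hj
      simp only [hz, hj']
      rw [if_neg (by omega)]
    rw [sum_congr rfl this, sum_const, nsmul_eq_mul]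
    have := hcard i
    rw [hi] at this
    field_simp
  refine ⟨z, y, fun i => ⟨?_, (hy0 i).le, (hy1 i).le⟩, fun i => ⟨hy0 i, hy1 i⟩, ?_⟩
  · by_cases h : p i = 0
    · simp [hz, h]
    · simp only [h, if_false, hz, hs, Set.mem_Icc]
      refine ⟨div_nonneg (hR0 _) (zero_le_one.trans (hcard i)), ?_⟩
      exact (div_le_self (hR0 _) (hcard i)).trans (hR1 _)
  · rw [sum_gVec_eq_zero_iff (w := fun i => (z i, y i))]
    intro ν
    have hν : (ν : ℕ) ≤ m := Fin.is_le ν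
    generalize (ν : ℕ) = l at hν
    simp only [gLS_succ_eq (hp _) _ _ hν, sum_add_distrib, sum_sub_distrib]
    have hin : (∑ i, if l = 0 then s i else 0) + (∑ i, if p i = l ∧ p i ≠ 0 then z i else 0) =
        R l := by
      rcases Nat.eq_zero_or_pos l with rfl | hl
      · have h1 : ∑ i with p i ≠ 0 ∧ p i ≤ 0, y i = 0 :=
          sum_eq_zero fun i hi => by simp at hi
        have h2 : (∑ i, if p i = 0 ∧ p i ≠ 0 then z i else 0) = 0 :=
          sum_eq_zero fun i _ => if_neg (by tauto)
        simp only [if_true, hsum, h2, hR, h1]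
        ring
      · rw [← hzsum l hl hν, sum_filter]
        simp only [hl.ne', if_false, sum_const_zero, zero_add]
        exact sum_congr rfl fun i _ => by grind
    have hout : (∑ i, if l = (if p i = 0 then m else p i - 1) then y i else 0) +
        (∑ i, if p i = l + 1 then z i else 0) = R l := by
      rcases hν.lt_or_eq with hl | rfl
      · have h1 := hzsum (l + 1) (by omega) (by omega)
        rw [sum_filter] at h1
        rw [h1]
        simp only [hR, sum_filter]
        have h2 : ∀ i, (if p i ≠ 0 ∧ p i ≤ l + 1 then y i else 0) =
            (if p i ≠ 0 ∧ p i ≤ l then y i else 0) +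
              (if l = (if p i = 0 then m else p i - 1) then y i else 0) := fun i => by grind
        rw [sum_congr rfl fun i _ => h2 i, sum_add_distrib]
        ring
      · have h1 : (∑ i, if p i = l + 1 then z i else 0) = 0 :=
          sum_eq_zero fun i _ => if_neg (by have := hp i; omega)
        rw [h1]
        simp only [hR, ← hysum, sum_filter, add_zero, ← sum_sub_distrib]
        exact sum_congr rfl fun i _ => by have := hp i; grind
    linarith

/-- With a positive load, the dual function is coercive. -/
lemma exists_isSaddle_of_pos (hp : ∀ i, p i ≤ m) (hMne : ∀ ℓ, 1 ≤ ℓ → ℓ ≤ m → ∃ i, p i = ℓ)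
    (hVMne : ∃ i, p i = 0) {ytot : ℝ} (hytot : 0 < ytot) (hs : ∀ i, (n : ℝ) * s i = ytot)
    (hymax : ∀ i, 0 < ymax i) (hsum : ∑ i, s i = ytot) (hlt : ytot < ∑ i, ymax i)
    (hF : ∀ i, Continuous (FPair n p s D r κ i)) {c : ℝ} (hc : 0 < c)
    (hgrow : ∀ i, HasQuadraticGrowth c (boxLS n p s ymax i) (FPair n p s D r κ i)
      (gVec n m p s i)) :
    ∃ η w, IsSaddle (boxLS n p s ymax) (FPair n p s D r κ) (gVec n m p s) η w := by
  obtain ⟨z, y, hbox, hy, hfeas⟩ := exists_slater hp hMne hytot hs hymax hsum hlt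
  have hne : Nonempty (Fin n) := ⟨hVMne.choose⟩
  obtain ⟨i₀, hi₀⟩ := Finite.exists_min fun i => min (y i) (ymax i - y i)
  set ε := min (y i₀) (ymax i₀ - y i₀) with hε
  have hεpos : 0 < ε := lt_min (hy i₀).1 (sub_pos.2 (hy i₀).2)
  have hε1 : ∀ i, ε ≤ y i ∧ ε ≤ ymax i - y i := fun i => le_min_iff.1 (hi₀ i)
  choose b hb using fun i => (isCompact_boxLS (n := n) (p := p) (s := s) (ymax := ymax) i).image
    (hF i) |>.bddAbove
  have hnd : ∀ i, (if p i = 0 then m else p i - 1) < m + 1 := fun i => by have := hp i; grind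
  set nd : Fin n → Fin (m + 1) := fun i => ⟨_, hnd i⟩ with hnddef
  have hsurj : Function.Surjective nd := fun ν => by
    rcases (Fin.is_le ν).lt_or_eq with h | h
    · obtain ⟨i, hi⟩ := hMne (ν + 1) (by omega) (by omega)
      exact ⟨i, Fin.ext (by simp [hnddef, hi])⟩
    · obtain ⟨i, hi⟩ := hVMne
      exact ⟨i, Fin.ext (by simp [hnddef, hi, h])⟩
  refine exists_isSaddle_of_coercive isCompact_boxLS (fun i => ⟨_, hbox i⟩) hF continuous_gVec hc
    hgrow hεpos (C := ∑ i, b i) fun η => ?_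
  set δ : Fin n → ℝ := fun i => if 0 ≤ η (nd i) then ε else -ε with hδ
  have hδη : ∀ i, η (nd i) * δ i = ε * |η (nd i)| := fun i => by
    simp only [hδ]
    split_ifs with h
    · rw [abs_of_nonneg h, mul_comm]
    · rw [abs_of_neg (not_le.1 h)]; ring
  have hwbox : ∀ i, (z i, y i + δ i) ∈ boxLS n p s ymax i := fun i => by
    refine ⟨(hbox i).1, ?_⟩
    have := hε1 i
    simp only [hδ, Set.mem_Icc]
    split_ifs <;> constructor <;> linarith
  refine ⟨fun i => (z i, y i + δ i), hwbox, ?_⟩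
  have hinner : ∀ i, inner ℝ η (gVec n m p s i (z i, y i + δ i)) =
      inner ℝ η (gVec n m p s i (z i, y i)) - ε * |η (nd i)| := fun i => by
    rw [← hδη, inner_gVec, inner_gVec]
    have h1 : ∀ ν : Fin (m + 1), η ν * gLS n m p s i (z i) (y i + δ i) (ν.val + 1) =
        η ν * gLS n m p s i (z i) (y i) (ν.val + 1) - (if ν = nd i then η ν * δ i else 0) :=
      fun ν => by
        simp only [gLS_succ_eq (hp i) _ _ (Fin.is_le ν), hnddef, Fin.ext_iff]
        split_ifs <;> ring
    simp only [h1, sum_sub_distrib, sum_ite_eq', mem_univ, if_true]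
  have hnorm : ‖η‖ ≤ ∑ i, |η (nd i)| := by
    have h1 : ‖η‖ ≤ ∑ ν, |η ν| := by
      rw [EuclideanSpace.norm_eq]
      refine Real.sqrt_le_iff.2 ⟨sum_nonneg fun _ _ => abs_nonneg _, ?_⟩
      exact sum_sq_le_sq_sum_of_nonneg fun _ _ => abs_nonneg _
    obtain ⟨σ, hσ⟩ := hsurj.hasRightInverse
    have h2 : ∑ ν, |η ν| = ∑ i ∈ univ.map ⟨σ, hσ.injective⟩, |η (nd i)| := by
      simp [sum_map, hσ _]
    rw [h2] at h1
    exact h1.trans (sum_le_univ_sum_of_nonneg fun i => abs_nonneg _)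
  have hFb : ∑ i, FPair n p s D r κ i (z i, y i + δ i) ≤ ∑ i, b i :=
    sum_le_sum fun i _ => hb i ⟨_, hwbox i, rfl⟩
  simp only [lagrangian, sum_add_distrib, hinner, sum_sub_distrib, ← inner_sum, hfeas,
    inner_zero_right, ← mul_sum]
  nlinarith

/-- Without load, shedding nothing is a saddle point for sufficiently negative multipliers. -/
lemma exists_isSaddle_of_zero (hp : ∀ i, p i ≤ m) (hs : ∀ i, s i = 0) (hymax : ∀ i, 0 < ymax i)
    (hD : ∀ i, p i = 0 → ConvexOn ℝ Set.univ (D i)) :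
    ∃ η w, IsSaddle (boxLS n p s ymax) (FPair n p s D r κ) (gVec n m p s) η w := by
  set C : ℝ := ∑ i, |r i - D i 0 + D i (-1)| with hC
  have hC0 : 0 ≤ C := sum_nonneg fun _ _ => abs_nonneg _
  refine ⟨WithLp.toLp 2 fun _ => -C, fun _ => (0, 0), fun i => ⟨?_, ?_⟩, ?_⟩
  · refine ⟨?_, le_rfl, (hymax i).le⟩
    split_ifs <;> simp [hs]
  · rintro ⟨a, b⟩ ⟨ha, hb, -⟩
    have ha0 : a = 0 := by
      simp only [hs, mul_zero, Set.Icc_self, ite_self] at ha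
      exact ha
    subst ha0
    have hsum : ∀ b : ℝ, ∑ ν : Fin (m + 1), -C * gLS n m p s i 0 b (ν.val + 1) = C * b :=
      fun b => by
        have hnd : (if p i = 0 then m else p i - 1) < m + 1 := by have := hp i; grind
        have h1 : ∀ ν : Fin (m + 1), -C * gLS n m p s i 0 b (ν.val + 1) =
            if ν = ⟨_, hnd⟩ then C * b else 0 := fun ν => by
          simp only [gLS_succ_eq (hp i) _ _ (Fin.is_le ν), hs, Fin.ext_iff]
          split_ifs <;> ring
        simp [h1]
    simp only [lagrangian_eq_Lls, Lls, hsum, Fls, hs]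
    simp only at hb
    split_ifs with h
    · have h1 := (hD i h).2 (Set.mem_univ b) (Set.mem_univ (-1))
        (by positivity : 0 ≤ 1 / (1 + b)) (by positivity : 0 ≤ b / (1 + b)) (by field_simp)
      have h2 : (1 / (1 + b)) • b + (b / (1 + b)) • (-1 : ℝ) = 0 := by
        simp only [smul_eq_mul]; ring
      rw [h2] at h1
      have h3 : (1 + b) * D i 0 ≤ D i b + b * D i (-1) := by
        have := mul_le_mul_of_nonneg_left h1 (by positivity : 0 ≤ 1 + b)
        refine this.trans (le_of_eq ?_)
        simp only [smul_eq_mul]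
        field_simp
      have h4 : r i - D i 0 + D i (-1) ≤ C := (le_abs_self _).trans
        (single_le_sum (f := fun i => |r i - D i 0 + D i (-1)|) (fun _ _ => abs_nonneg _)
          (mem_univ i))
      nlinarith [mul_le_mul_of_nonneg_right h4 hb]
    · simp only [mul_zero, zero_div, sub_zero]
      nlinarith [mul_nonneg hC0 hb, sq_nonneg b]
  · rw [sum_gVec_eq_zero_iff (w := fun _ => ((0 : ℝ), (0 : ℝ)))]
    intro ν
    refine sum_eq_zero fun i _ => ?_
    simp [gLS_succ_eq (hp i) _ _ (Fin.is_le ν), hs]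

end LoadShedding

/-- Theorem 3: connectivity of the communication graph, strong
convexity of the costs `D_i`, Assumption 8, a graph-compatible doubly
stochastic weight matrix and square-summable but non-summable step sizes
guarantee that the distributed dual subgradient iterates of the
priority-considered load shedding problem (20) converge: the local multipliers
`η_i(k)` converge to a dual optimal `η̄` of the dual of (20) and the local
primal iterates `(z_i(k), y_i(k))` converge to the unique optimal solution
`(z̄, ȳ)` of (20). -/
theorem distributed_load_shedding_convergence
    (n m : ℕ) (hn : 0 < n)
    -- priority structure: each M_ℓ nonempty, V \ M nonempty
    (p : Fin n → ℕ) (hp : ∀ i, p i ≤ m)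
    (hMne : ∀ ℓ, 1 ≤ ℓ → ℓ ≤ m → ∃ i, p i = ℓ)
    (hVMne : ∃ i, p i = 0)
    -- shedding data
    (ytot : ℝ) (hytot : 0 ≤ ytot)
    (s : Fin n → ℝ) (hs : ∀ i, s i = ytot / n)
    (ymax : Fin n → ℝ) (hymax : ∀ i, 0 < ymax i)
    -- Assumption 8
    (hA8 : ∑ i, s i < ∑ i, ymax i) (hA8' : ∑ i, s i = ytot)
    -- costs: D_i strongly convex for regular buses, incentives r_i > 0, κ ≥ 1
    (D : Fin n → ℝ → ℝ) (cD : Fin n → ℝ)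
    (hD : ∀ i, p i = 0 → 0 < cD i ∧ StrongConvexOn Set.univ (cD i) (D i))
    (r : Fin n → ℝ) (hr : ∀ i, p i = 0 → 0 < r i)
    (κ : ℝ) (hκ : 1 ≤ κ)
    -- undirected connected communication graph
    (G : SimpleGraph (Fin n)) (hconn : G.Connected)
    -- doubly stochastic weight matrix compatible with the graph
    (A : Matrix (Fin n) (Fin n) ℝ)
    (hAnonneg : ∀ i j, 0 ≤ A i j)
    (hArow : ∀ i, ∑ j, A i j = 1) (hAcol : ∀ j, ∑ i, A i j = 1)
    (hAdiag : ∀ i, 0 < A i i)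
    (hAadj : ∀ i j, i ≠ j → (0 < A i j ↔ G.Adj i j))
    -- step sizes: positive, non-summable, square-summable
    (α : ℕ → ℝ) (hαpos : ∀ k, 0 < α k)
    (hαdiv : ¬ Summable α)
    (hαsq : Summable fun k => (α k) ^ 2)
    -- the iterates of the distributed algorithm
    (z y : Fin n → ℕ → ℝ)
    (η φ : Fin n → ℕ → Fin (m + 1) → ℝ)
    (hminstep : ∀ i k,
      (z i (k + 1), y i (k + 1)) ∈ boxLS n p s ymax i ∧
      ∀ q ∈ boxLS n p s ymax i,
        Lls n m p s D r κ i (z i (k + 1)) (y i (k + 1)) (φ i k) ≤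
          Lls n m p s D r κ i q.1 q.2 (φ i k))
    (hηupd : ∀ i k (ν : Fin (m + 1)), η i (k + 1) ν =
      φ i k ν + α k * gLS n m p s i (z i (k + 1)) (y i (k + 1)) (ν.val + 1))
    (hφupd : ∀ i k (ν : Fin (m + 1)), φ i (k + 1) ν =
      ∑ j, A i j * η j (k + 1) ν) :
    ∃ (ηb : Fin (m + 1) → ℝ) (zb yb : Fin n → ℝ),
      -- η̄ is dual optimal for the dual of problem (20)
      (∀ η' : Fin (m + 1) → ℝ,
        ∑ i, sInf ((fun q : ℝ × ℝ => Lls n m p s D r κ i q.1 q.2 η') ''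
            boxLS n p s ymax i) ≤
          ∑ i, sInf ((fun q : ℝ × ℝ => Lls n m p s D r κ i q.1 q.2 ηb) ''
            boxLS n p s ymax i)) ∧
      -- (z̄, ȳ) is the unique optimal solution of problem (20)
      Feas20 n m p s ymax zb yb ∧
      (∀ z' y' : Fin n → ℝ, Feas20 n m p s ymax z' y' →
        ∑ i, Fls n p s D r κ i (zb i) (yb i) ≤
          ∑ i, Fls n p s D r κ i (z' i) (y' i)) ∧
      (∀ z' y' : Fin n → ℝ,
        (Feas20 n m p s ymax z' y' ∧
          ∀ z'' y'' : Fin n → ℝ, Feas20 n m p s ymax z'' y'' →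
            ∑ i, Fls n p s D r κ i (z' i) (y' i) ≤
              ∑ i, Fls n p s D r κ i (z'' i) (y'' i)) →
        z' = zb ∧ y' = yb) ∧
      -- convergence of all local iterates
      (∀ i, Tendsto (fun k => η i k) atTop (nhds ηb)) ∧
      (∀ i, Tendsto (fun k => z i k) atTop (nhds (zb i))) ∧
      (∀ i, Tendsto (fun k => y i k) atTop (nhds (yb i))) := by
  have hne : Nonempty (Fin n) := ⟨⟨0, hn⟩⟩
  have hns : ∀ i, (n : ℝ) * s i = ytot := fun i => by
    rw [hs]
    field_simp
  obtain ⟨i₀, hi₀⟩ := Finite.exists_min fun i : Fin n =>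
    min (1 / 4) (if p i = 0 then cD i / 8 else 1)
  set c := min (1 / 4) (if p i₀ = 0 then cD i₀ / 8 else 1) with hc
  have hcpos : 0 < c := by
    refine lt_min (by norm_num) ?_
    split_ifs with h
    · linarith [(hD i₀ h).1]
    · exact one_pos
  have hgrow : ∀ i, HasQuadraticGrowth (2 * c) (boxLS n p s ymax i) (FPair n p s D r κ i)
      (gVec n m p s i) := fun i => by
    refine hasQuadraticGrowth_FPair hp hκ (min_le_left _ _) i fun h => ⟨?_, (hD i h).2⟩
    exact ((hi₀ i).trans (min_le_right _ _)).trans_eq (if_pos h)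
  have hF : ∀ i, Continuous (FPair n p s D r κ i) := fun i => by
    by_cases h : p i = 0
    · exact continuous_FPair (hD i h).1.le i fun _ => (hD i h).2
    · exact continuous_FPair le_rfl i fun h' => absurd h' h
  obtain ⟨η₀, ws, hsad₀⟩ :
      ∃ η w, IsSaddle (boxLS n p s ymax) (FPair n p s D r κ) (gVec n m p s) η w := by
    rcases hytot.lt_or_eq with h | h
    · exact exists_isSaddle_of_pos hp hMne hVMne h hns hymax hA8' (hA8' ▸ hA8) hF
        (mul_pos two_pos hcpos) hgrow
    · refine exists_isSaddle_of_zero hp (fun i => by simp [hs, ← h]) hymax fun i hi => ?_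
      refine UniformConvexOn.convexOn (hD i hi).2 fun t => ?_
      have := (hD i hi).1
      simp only [Pi.zero_apply]
      positivity
  set w : Fin n → ℕ → ℝ × ℝ := fun i k => (z i (k + 1), y i (k + 1)) with hw
  have hη : ∀ i k, (WithLp.toLp 2 (η i (k + 1)) : EuclideanSpace ℝ (Fin (m + 1))) =
      WithLp.toLp 2 (φ i k) + α k • gVec n m p s i (w i k) := fun i k => by
    ext ν
    simp [hηupd, gVec, hw]
  obtain ⟨ηb, hsad, hφlim, hwlim⟩ := distributed_dual_subgradient_tendsto G hconn A hAnonneg hArow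
    hAcol hAdiag (fun i j hij => (hAadj i j hij.ne).2 hij) hαpos hαdiv hαsq hF continuous_gVec
    isCompact_boxLS (mul_pos two_pos hcpos) hgrow hsad₀ (w := w)
    (φ := fun i k => WithLp.toLp 2 (φ i k))
    (fun i k => ⟨(hminstep i k).1, fun q hq => by
      simpa only [lagrangian_eq_Lls] using (hminstep i k).2 q hq⟩)
    (fun i k => by
      simp only [← hη]
      ext ν
      simp [hφupd])
  have hfeas : Feas20 n m p s ymax (fun i => (ws i).1) (fun i => (ws i).2) :=
    feas20_iff.2 ⟨fun i => (hsad.1 i).1, hsad.2⟩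
  have hopt : ∀ z' y' : Fin n → ℝ, Feas20 n m p s ymax z' y' →
      ∑ i, Fls n p s D r κ i (ws i).1 (ws i).2 + 2 * c * ∑ i, dist (ws i) (z' i, y' i) ^ 2 ≤
        ∑ i, Fls n p s D r κ i (z' i) (y' i) := fun z' y' h =>
    hsad.quadratic_growth hgrow (w' := fun i => (z' i, y' i)) (feas20_iff.1 h).1 (feas20_iff.1 h).2
  have hdist : ∀ z' y' : Fin n → ℝ, 0 ≤ ∑ i, dist (ws i) (z' i, y' i) ^ 2 :=
    fun z' y' => sum_nonneg fun i _ => sq_nonneg _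
  refine ⟨ηb.ofLp, fun i => (ws i).1, fun i => (ws i).2, fun η' => ?_, hfeas, fun z' y' h => ?_,
    fun z' y' h => ?_, fun i => ?_, fun i => ?_, fun i => ?_⟩
  · have h := hsad.dual_optimal isCompact_boxLS hF continuous_gVec (WithLp.toLp 2 η')
    rw [← WithLp.toLp_ofLp 2 ηb] at h
    simpa only [lagrangian_eq_Lls] using h
  · nlinarith [hopt z' y' h, mul_nonneg hcpos.le (hdist z' y')]
  · have h1 := hopt z' y' h.1
    have h2 := h.2 _ _ hfeas
    have h3 : ∑ i, dist (ws i) (z' i, y' i) ^ 2 = 0 :=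
      le_antisymm (by nlinarith [hdist z' y']) (hdist z' y')
    have h4 : ∀ i, ws i = (z' i, y' i) := fun i => by
      have := (sum_eq_zero_iff_of_nonneg fun i _ => sq_nonneg _).1 h3 i (mem_univ i)
      exact dist_eq_zero.1 (pow_eq_zero_iff two_ne_zero |>.1 this)
    exact ⟨funext fun i => by simp [h4], funext fun i => by simp [h4]⟩
  · have hα0 : Tendsto α atTop (nhds 0) := by
      simpa [Real.sqrt_sq (hαpos _).le] using hαsq.tendsto_atTop_zero.sqrt
    have h1 : Tendsto (fun k => (WithLp.toLp 2 (η i (k + 1)) : EuclideanSpace ℝ (Fin (m + 1))))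
        atTop (nhds ηb) := by
      simp only [hη]
      simpa using (hφlim i).add (hα0.smul (((continuous_gVec i).tendsto _).comp (hwlim i)))
    exact (tendsto_add_atTop_iff_nat 1).1 (((PiLp.continuous_ofLp 2 _).tendsto ηb).comp h1)
  · exact (tendsto_add_atTop_iff_nat 1).1 ((continuous_fst.tendsto _).comp (hwlim i))
  · exact (tendsto_add_atTop_iff_nat 1).1 ((continuous_snd.tendsto _).comp (hwlim i))
end

section
/- Consider problem P2: minimize Σ_{i∈V} s_i² + τ Σ_{i∈V} x_i² with τ > 0, over s_i ≥ 0 (i∈V), x_i ∈ X_i (i∈V), and u ∈ ℝⁿ, subject to Σ_{i∈V}(u_i² + d_i − x_i − s_i) ≤ 0 and Rx = u. Assume 0 ≤ x_i^min ≤ x_i^max, d_i ≥ 0 for all i, B = RᵀR is symmetric positive semidefinite, Σ_{i∈V} x_i^min < Σ_{i∈V} d_i + Υ(x^min), and the Slater condition: there exist x̃_i ∈ (x_i^min, x_i^max) and s̃_i > 0 with Σ_{i∈V}(ũ_i² + d_i − x̃_i − s̃_i) < 0, where ũ = Rx̃. Then any optimal solution (x̄, ū, s̄) of P2 satisfies the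 balance with equality, Σ_{i∈V}(ū_i² + d_i − x̄_i − s̄_i) = 0, i.e., Σ_{i∈V} s̄_i = Υ(x̄) + Σ_{i∈V}(d_i − x̄_i); moreover s̄_i = s̄_j for all i, j ∈ V. -/
open Matrix Finset

/-- Real numbers whose sum of squares is at most that of their constant rearrangement to the mean
are all equal to the mean. -/
theorem eq_mean_of_sum_sq_le {n : ℕ} (s : Fin n → ℝ)
    (h : ∑ i, s i ^ 2 ≤ ∑ _i : Fin n, ((∑ k, s k) / n) ^ 2) (i : Fin n) :
    s i = (∑ k, s k) / n := by
  have hn : (n : ℝ) ≠ 0 := by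
    have := i.pos
    positivity
  set m := (∑ k, s k) / n with hm
  have hsum : ∑ k, s k = n * m := by
    rw [hm]
    field_simp
  have hvar : ∑ k, (s k - m) ^ 2 ≤ 0 := by
    have hexpand : ∑ k, (s k - m) ^ 2 = ∑ k, s k ^ 2 - 2 * m * ∑ k, s k + n * m ^ 2 := by
      simp only [sub_sq, sum_add_distrib, sum_sub_distrib, mul_sum, sum_const, card_univ,
        Fintype.card_fin, nsmul_eq_mul]
      congr 2
      exact sum_congr rfl fun k _ => by ring
    simp only [sum_const, card_univ, Fintype.card_fin, nsmul_eq_mul] at h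
    rw [hexpand, hsum]
    linarith
  have hi := (single_le_sum (f := fun k => (s k - m) ^ 2) (fun k _ => sq_nonneg _)
    (mem_univ i)).trans hvar
  exact sub_eq_zero.mp (pow_eq_zero_iff two_ne_zero |>.mp (le_antisymm hi (sq_nonneg _)))

theorem sq_convex_combination_le {e : ℝ} (h0 : 0 ≤ e) (h1 : e ≤ 1) (a b : ℝ) :
    ((1 - e) * a + e * b) ^ 2 ≤ (1 - e) * a ^ 2 + e * b ^ 2 := by
  nlinarith [mul_nonneg (mul_nonneg h0 (sub_nonneg.mpr h1)) (sq_nonneg (a - b))]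

/-- Under positive semidefiniteness of `B = RᵀR`, the infeasibility
condition `Σ_i x_i^min < Σ_i d_i + Υ(x^min)` and a Slater condition, any optimal
solution `(x̄, ū, s̄)` of the relaxed feasibility problem P2 satisfies the supply
balance with equality, `Σ_i (ū_i² + d_i − x̄_i − s̄_i) = 0` (equivalently
`Σ_i s̄_i = Υ(x̄) + Σ_i (d_i − x̄_i)`), and has all shedding components equal. -/
theorem P2_optimal_properties
    (n : ℕ) (τ : ℝ) (hτ : 0 < τ)
    (xmin xmax d : Fin n → ℝ) (B R : Matrix (Fin n) (Fin n) ℝ)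
    (hBR : B = Rᵀ * R) (hBsym : B.IsSymm) (hBpsd : B.PosSemidef)
    (hxm : ∀ i, 0 ≤ xmin i) (hxmm : ∀ i, xmin i ≤ xmax i) (hd : ∀ i, 0 ≤ d i)
    (hinfeas : ∑ i, xmin i < ∑ i, d i + xmin ⬝ᵥ B.mulVec xmin)
    (hSlater : ∃ xt st : Fin n → ℝ,
      (∀ i, xt i ∈ Set.Ioo (xmin i) (xmax i)) ∧ (∀ i, 0 < st i) ∧
      ∑ i, ((R.mulVec xt i) ^ 2 + d i - xt i - st i) < 0)
    (xb ub sb : Fin n → ℝ)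
    (hfeas : (∀ i, 0 ≤ sb i) ∧ (∀ i, xb i ∈ Set.Icc (xmin i) (xmax i)) ∧
      (∑ i, ((ub i) ^ 2 + d i - xb i - sb i) ≤ 0) ∧ R.mulVec xb = ub)
    (hopt : ∀ s' x' u' : Fin n → ℝ,
      ((∀ i, 0 ≤ s' i) ∧ (∀ i, x' i ∈ Set.Icc (xmin i) (xmax i)) ∧
        (∑ i, ((u' i) ^ 2 + d i - x' i - s' i) ≤ 0) ∧ R.mulVec x' = u') →
      ∑ i, (sb i) ^ 2 + τ * ∑ i, (xb i) ^ 2 ≤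
        ∑ i, (s' i) ^ 2 + τ * ∑ i, (x' i) ^ 2) :
    (∑ i, ((ub i) ^ 2 + d i - xb i - sb i) = 0) ∧
    (∑ i, sb i = xb ⬝ᵥ B.mulVec xb + ∑ i, (d i - xb i)) ∧
    (∀ i j, sb i = sb j) := by
  obtain ⟨hs, hx, hg, rfl⟩ := hfeas
  subst hBR
  rw [dotProduct_transpose_mul_self_mulVec] at hinfeas
  have hbalance : ∑ i, ((R.mulVec xb i) ^ 2 + d i - xb i - sb i) = 0 := by
    by_contra hne
    have hneg := lt_of_le_of_ne hg hne
    have hpos : 0 < ∑ i, ((R.mulVec xmin i) ^ 2 + d i - xmin i) := by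
      simp only [sum_sub_distrib, sum_add_distrib]
      linarith
    set g := ∑ i, ((R.mulVec xb i) ^ 2 + d i - xb i - sb i) with hgdef
    set g₀ := ∑ i, ((R.mulVec xmin i) ^ 2 + d i - xmin i) with hg₀def
    obtain ⟨e, he0, he1, he⟩ : ∃ e : ℝ, 0 < e ∧ e < 1 ∧ (1 - e) * g + e * g₀ = 0 := by
      have hd0 : 0 < g₀ - g := by linarith
      refine ⟨-g / (g₀ - g), by apply div_pos <;> linarith, by rw [div_lt_one hd0]; linarith, ?_⟩
      field_simp
      ring
    have hmul : R.mulVec ((1 - e) • xb + e • xmin) =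
        (1 - e) • R.mulVec xb + e • R.mulVec xmin := by
      rw [mulVec_add, mulVec_smul, mulVec_smul]
    have hle := hopt ((1 - e) • sb) ((1 - e) • xb + e • xmin) _ ⟨?_, ?_, ?_, hmul⟩
    · simp only [Pi.add_apply, Pi.smul_apply, smul_eq_mul] at hle
      have hs' : ∑ i, ((1 - e) * sb i) ^ 2 ≤ (1 - e) * ∑ i, sb i ^ 2 := by
        rw [mul_sum]
        exact sum_le_sum fun i _ => by
          simpa using sq_convex_combination_le he0.le he1.le (sb i) 0
      have hx' : ∑ i, ((1 - e) * xb i + e * xmin i) ^ 2 ≤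
          (1 - e) * ∑ i, xb i ^ 2 + e * ∑ i, xmin i ^ 2 := by
        rw [mul_sum, mul_sum, ← sum_add_distrib]
        exact sum_le_sum fun i _ => sq_convex_combination_le he0.le he1.le _ _
      have hτx := mul_le_mul_of_nonneg_left hx' hτ.le
      have hgap : ∑ i, sb i ^ 2 + τ * ∑ i, (xb i ^ 2 - xmin i ^ 2) ≤ 0 := by
        rw [sum_sub_distrib]
        refine nonpos_of_mul_nonpos_right ?_ he0
        linarith
      have hxterm : ∀ i ∈ univ, 0 ≤ xb i ^ 2 - xmin i ^ 2 := fun i _ =>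
        sub_nonneg.mpr (pow_le_pow_left₀ (hxm i) (hx i).1 2)
      have hsnn : 0 ≤ ∑ i, sb i ^ 2 := sum_nonneg fun i _ => sq_nonneg _
      have hxnn : 0 ≤ ∑ i, (xb i ^ 2 - xmin i ^ 2) := sum_nonneg hxterm
      have hs0 : ∑ i, sb i ^ 2 = 0 := by linarith [mul_nonneg hτ.le hxnn]
      have hx0 : ∑ i, (xb i ^ 2 - xmin i ^ 2) = 0 :=
        le_antisymm (nonpos_of_mul_nonpos_right (by linarith) hτ) hxnn
      have hsb : ∀ i, sb i = 0 := fun i => pow_eq_zero_iff two_ne_zero |>.mp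
        ((sum_eq_zero_iff_of_nonneg fun i _ => sq_nonneg (sb i)).mp hs0 i (mem_univ i))
      have hxb : xb = xmin := funext fun i =>
        (pow_left_inj₀ ((hxm i).trans (hx i).1) (hxm i) two_ne_zero).mp <| sub_eq_zero.mp
          ((sum_eq_zero_iff_of_nonneg hxterm).mp hx0 i (mem_univ i))
      have hgg : g = g₀ := by simp [hgdef, hg₀def, hsb, hxb]
      linarith
    · exact fun i => mul_nonneg (by linarith) (hs i)
    · exact fun i => convex_Icc _ _ (hx i) ⟨le_rfl, hxmm i⟩ (by linarith) he0.le (by ring)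
    · rw [← he, hgdef, hg₀def, mul_sum, mul_sum, ← sum_add_distrib]
      refine sum_le_sum fun i _ => ?_
      simp only [Pi.add_apply, Pi.smul_apply, smul_eq_mul]
      linarith [sq_convex_combination_le he0.le he1.le (R.mulVec xb i) (R.mulVec xmin i)]
  refine ⟨hbalance, ?_, ?_⟩
  · rw [dotProduct_transpose_mul_self_mulVec]
    simp only [sum_sub_distrib, sum_add_distrib] at hbalance ⊢
    linarith
  · have hmean : ∑ i, sb i ^ 2 ≤ ∑ _i : Fin n, ((∑ k, sb k) / n) ^ 2 := by
      refine le_of_add_le_add_right (hopt (fun _ => (∑ k, sb k) / n) xb _ ⟨?_, hx, ?_, rfl⟩)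
      · exact fun _ => div_nonneg (sum_nonneg fun k _ => hs k) n.cast_nonneg
      · rcases n.eq_zero_or_pos with rfl | hn
        · simp
        · have hn' : (n : ℝ) ≠ 0 := by positivity
          have hsum : ∑ _i : Fin n, (∑ k, sb k) / n = ∑ k, sb k := by
            simp only [sum_const, card_univ, Fintype.card_fin, nsmul_eq_mul]
            field_simp
          rw [sum_sub_distrib] at hg ⊢
          rwa [hsum]
    intro i j
    rw [eq_mean_of_sum_sq_le sb hmean i, ← eq_mean_of_sum_sq_le sb hmean j]
end

section
/- Consider problems P1 and P2 as defined. Assume 0 ≤ x_i^min ≤ x_i^max, d_i ≥ 0 for all i, B = RᵀR is symmetric positive semidefinite, Σ_{i∈V} x_i^min < Σ_{i∈V} d_i + Υ(x^min), and the Slater condition for P2 holds: there exist x̃_i ∈ (x_i^min, x_i^max) and s̃_i > 0 with Σ_{i∈V}(ũ_i² + d_i − x̃_i − s̃_i) < 0, where ũ = Rx̃. Let (s*, x*) be an optimal solution of P1 and (x̄, ū, s̄) an optimal solution of P2 with τ > 0. Then Σ_{i∈V} s̄_i ≥ Σ_{i∈V} s_i*; i.e., the total load shedding determined by P2 is at least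 the minimal total load shedding determined by P1. -/
open Matrix Finset

/-- A continuous function on a box that is nonnegative at `a` and at most `S` at `b`, with `0 ≤ S`,
takes a value in `[0, S]` on the box. -/
theorem exists_mem_Icc_of_continuous_box {ι : Type*} {l u a b : ι → ℝ} {c : (ι → ℝ) → ℝ} {S : ℝ}
    (hc : Continuous c) (ha : ∀ i, a i ∈ Set.Icc (l i) (u i))
    (hb : ∀ i, b i ∈ Set.Icc (l i) (u i)) (hca : 0 ≤ c a) (hcb : c b ≤ S) (hS : 0 ≤ S) :
    ∃ x : ι → ℝ, (∀ i, x i ∈ Set.Icc (l i) (u i)) ∧ 0 ≤ c x ∧ c x ≤ S := by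
  rcases le_total 0 (c b) with h | h
  · exact ⟨b, hb, h, hcb⟩
  · have hpre : IsPreconnected (Set.univ.pi fun i => Set.Icc (l i) (u i)) :=
      isPreconnected_univ_pi fun i => isPreconnected_Icc
    obtain ⟨x, hx, hx0⟩ := hpre.intermediate_value (fun i _ => hb i) (fun i _ => ha i)
      hc.continuousOn ⟨h, hca⟩
    exact ⟨x, fun i => hx i trivial, hx0.ge, hx0.le.trans hS⟩


/-- The total load shedding produced by the relaxed problem P2 is
at least the minimal total load shedding produced by the feasibility problem P1:
if `(s*, x*)` is optimal for P1 and `(x̄, ū, s̄)` is optimal for P2 (with `τ > 0`),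
then `Σ_i s̄_i ≥ Σ_i s_i*`. -/
theorem P2_total_shedding_ge_P1
    (n : ℕ) (τ : ℝ) (hτ : 0 < τ)
    (xmin xmax d : Fin n → ℝ) (B R : Matrix (Fin n) (Fin n) ℝ)
    (hBR : B = Rᵀ * R) (hBsym : B.IsSymm) (hBpsd : B.PosSemidef)
    (hxm : ∀ i, 0 ≤ xmin i) (hxmm : ∀ i, xmin i ≤ xmax i) (hd : ∀ i, 0 ≤ d i)
    (hinfeas : ∑ i, xmin i < ∑ i, d i + xmin ⬝ᵥ B.mulVec xmin)
    (hSlater : ∃ xt st : Fin n → ℝ,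
      (∀ i, xt i ∈ Set.Ioo (xmin i) (xmax i)) ∧ (∀ i, 0 < st i) ∧
      ∑ i, ((R.mulVec xt i) ^ 2 + d i - xt i - st i) < 0)
    -- (s*, x*) optimal for P1
    (ss xs : Fin n → ℝ)
    (hfeas1 : (∀ i, 0 ≤ ss i) ∧ (∀ i, xs i ∈ Set.Icc (xmin i) (xmax i)) ∧
      xs ⬝ᵥ B.mulVec xs + ∑ i, (d i - xs i - ss i) = 0)
    (hopt1 : ∀ s' x' : Fin n → ℝ,
      ((∀ i, 0 ≤ s' i) ∧ (∀ i, x' i ∈ Set.Icc (xmin i) (xmax i)) ∧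
        x' ⬝ᵥ B.mulVec x' + ∑ i, (d i - x' i - s' i) = 0) →
      ∑ i, (ss i) ^ 2 ≤ ∑ i, (s' i) ^ 2)
    -- (x̄, ū, s̄) optimal for P2
    (xb ub sb : Fin n → ℝ)
    (hfeas2 : (∀ i, 0 ≤ sb i) ∧ (∀ i, xb i ∈ Set.Icc (xmin i) (xmax i)) ∧
      (∑ i, ((ub i) ^ 2 + d i - xb i - sb i) ≤ 0) ∧ R.mulVec xb = ub)
    (hopt2 : ∀ s' x' u' : Fin n → ℝ,
      ((∀ i, 0 ≤ s' i) ∧ (∀ i, x' i ∈ Set.Icc (xmin i) (xmax i)) ∧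
        (∑ i, ((u' i) ^ 2 + d i - x' i - s' i) ≤ 0) ∧ R.mulVec x' = u') →
      ∑ i, (sb i) ^ 2 + τ * ∑ i, (xb i) ^ 2 ≤
        ∑ i, (s' i) ^ 2 + τ * ∑ i, (x' i) ^ 2) :
    ∑ i, ss i ≤ ∑ i, sb i := by
  obtain ⟨hsb, hxb, hcon, rfl⟩ := hfeas2
  rcases Nat.eq_zero_or_pos n with rfl | hn
  · simp
  have hn' : (0 : ℝ) < n := by exact_mod_cast hn
  let c : (Fin n → ℝ) → ℝ := fun x => x ⬝ᵥ B.mulVec x + ∑ i, d i - ∑ i, x i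
  have hc : Continuous c := by
    simp only [c, dotProduct, Matrix.mulVec]
    fun_prop
  have hquad : xb ⬝ᵥ B.mulVec xb = ∑ i, (R.mulVec xb i) ^ 2 := by
    rw [hBR, ← Matrix.mulVec_mulVec, Matrix.dotProduct_mulVec, Matrix.vecMul_transpose]
    simp only [dotProduct, sq]
  have hcb : c xb ≤ ∑ i, sb i := by
    simp only [sum_sub_distrib, sum_add_distrib] at hcon
    simp only [c, hquad]
    linarith
  have hcmin : 0 ≤ c xmin := by
    simp only [c]
    linarith
  obtain ⟨x, hx, hx0, hxS⟩ := exists_mem_Icc_of_continuous_box hc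
    (fun i => ⟨le_rfl, hxmm i⟩) hxb hcmin hcb (sum_nonneg fun i _ => hsb i)
  have hopt := hopt1 (fun _ => c x / n) x ⟨fun _ => by positivity, hx, by
    simp only [sum_sub_distrib, sum_const, card_univ, Fintype.card_fin, nsmul_eq_mul]
    rw [mul_div_cancel₀ _ hn'.ne']
    simp only [c]
    ring⟩
  simp only [sum_const, card_univ, Fintype.card_fin, nsmul_eq_mul] at hopt
  have hcs : (∑ i, ss i) ^ 2 ≤ n * ∑ i, ss i ^ 2 := by
    simpa using sq_sum_le_card_mul_sum_sq (s := univ) (f := ss)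
  have hsq : (∑ i, ss i) ^ 2 ≤ c x ^ 2 :=
    calc (∑ i, ss i) ^ 2 ≤ n * ∑ i, ss i ^ 2 := hcs
      _ ≤ n * (n * (c x / n) ^ 2) := by gcongr
      _ = c x ^ 2 := by field_simp
  exact (abs_le_of_sq_le_sq' hsq hx0).2.trans hxS
end
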